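/- For every ranked alphabet Σ and every k ≥ 1, every tree language over Σ definable in first-order logic with positive occurrences of k-ary transitive closure is accepted by a nondeterministic k-head tree-walking automaton with nested pebbles: FO+posTC^k ⊆ NPTWA^k. -/

import Mathlib

namespace NestedPebbles

/-- Trees over a ranked alphabet `(Sig, rank)`: terms `σ(t₁,…,tₙ)` with `rank σ = n`. -/
inductive RTree (Sig : Type) (rank : Sig → ℕ) : Type
  | node (a : Sig) (children : Fin (rank a) → RTree Sig rank) : RTree Sig rank

namespace RTree

variable {Sig : Type} {rank : Sig → ℕ}

/-- The label of the root symbol. -/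
def label : RTree Sig rank → Sig
  | node a _ => a

/-- The `i`-th (0-based) immediate subtree, if it exists. -/
def child : RTree Sig rank → ℕ → Option (RTree Sig rank)
  | node a c, i => if h : i < rank a then some (c ⟨i, h⟩) else none

/-- The subtree at a position (a list of 0-based child indices, read from the root). -/
def subtree : RTree Sig rank → List ℕ → Option (RTree Sig rank)
  | t, [] => some t
  | t, i :: p => (t.child i).bind fun s => s.subtree p

end RTree

variable {Sig : Type} {rank : Sig → ℕ}

/-- `p` is (the address of) a node of `t`. -/
def IsPos (t : RTree Sig rank) (p : List ℕ) : Prop := (t.subtree p).isSome = true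

/-- The type of nodes of a tree `t`, as valid positions. -/
def Pos (t : RTree Sig rank) : Type := { p : List ℕ // IsPos t p }

/-- The root node. -/
def rootPos (t : RTree Sig rank) : Pos t := ⟨[], rfl⟩

/-- The label of the node of `t` at position `p`. -/
def labelAt (t : RTree Sig rank) (p : List ℕ) : Option Sig := (t.subtree p).map RTree.label

/-- The child number of a node: `0` for the root, and `j` for a `j`-th child (1-based). -/
def childNo (p : List ℕ) : ℕ :=
  match p.getLast? with
  | none => 0
  | some j => j + 1

/-!  ### First-order logic with k-ary transitive closure, on trees  -/

/-- First-order formulas over a ranked alphabet, with a `k`-ary transitive closure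
operator.  Variables are natural numbers.  `lab a x` means `x` has label `a`;
`edg i x y` means `y` is the `i`-th child of `x` (`i` is 1-based);
`le x y` means `x` is an ancestor of `y`; `tc xs ys φ us vs` is the transitive
closure `φ*` of `φ` with respect to the tuples of variables `xs`, `ys` (which it
binds), applied to the tuples of variables `us`, `vs`. -/
inductive TForm (Sig : Type) (rank : Sig → ℕ) (k : ℕ) : Type
  | lab (a : Sig) (x : ℕ)
  | edg (i : ℕ) (x y : ℕ)
  | le (x y : ℕ)
  | eq (x y : ℕ)
  | not (φ : TForm Sig rank k)
  | and (φ ψ : TForm Sig rank k)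
  | or (φ ψ : TForm Sig rank k)
  | ex (x : ℕ) (φ : TForm Sig rank k)
  | all (x : ℕ) (φ : TForm Sig rank k)
  | tc (xs ys : Fin k → ℕ) (φ : TForm Sig rank k) (us vs : Fin k → ℕ)

/-- Update a valuation on a tuple of variables simultaneously. -/
noncomputable def updVec {α : Type} {k : ℕ} (ν : ℕ → α) (xs : Fin k → ℕ) (a : Fin k → α) :
    ℕ → α :=
  fun n => if h : ∃ i, xs i = n then a h.choose else ν n

/-- Satisfaction of a formula in a tree `t` under a valuation of the variables by
nodes of `t`. -/
def Sat {k : ℕ} (t : RTree Sig rank) : TForm Sig rank k → (ℕ → Pos t) → Prop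
  | .lab a x, ν => labelAt t (ν x).1 = some a
  | .edg i x y, ν => 1 ≤ i ∧ (ν y).1 = (ν x).1 ++ [i - 1]
  | .le x y, ν => (ν x).1 <+: (ν y).1
  | .eq x y, ν => ν x = ν y
  | .not φ, ν => ¬ Sat t φ ν
  | .and φ ψ, ν => Sat t φ ν ∧ Sat t ψ ν
  | .or φ ψ, ν => Sat t φ ν ∨ Sat t ψ ν
  | .ex x φ, ν => ∃ u : Pos t, Sat t φ (Function.update ν x u)
  | .all x φ, ν => ∀ u : Pos t, Sat t φ (Function.update ν x u)
  | .tc xs ys φ us vs, ν =>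
      Relation.ReflTransGen
        (fun a b : Fin k → Pos t => Sat t φ (updVec (updVec ν xs a) ys b))
        (fun i => ν (us i)) (fun i => ν (vs i))

/-- The free variables of a formula. -/
def freeVars {k : ℕ} : TForm Sig rank k → Set ℕ
  | .lab _ x => {x}
  | .edg _ x y => {x, y}
  | .le x y => {x, y}
  | .eq x y => {x, y}
  | .not φ => freeVars φ
  | .and φ ψ => freeVars φ ∪ freeVars ψ
  | .or φ ψ => freeVars φ ∪ freeVars ψ
  | .ex x φ => freeVars φ \ {x}
  | .all x φ => freeVars φ \ {x}
  | .tc xs ys φ us vs =>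
      (freeVars φ \ (Set.range xs ∪ Set.range ys)) ∪ Set.range us ∪ Set.range vs

/-- Two `k`-tuples of variables consist of `2k` pairwise distinct variables. -/
def Distinct2 {k : ℕ} (xs ys : Fin k → ℕ) : Prop :=
  Function.Injective xs ∧ Function.Injective ys ∧ ∀ i j, xs i ≠ ys j

/-- `φ` is functional in the tuples of variables `xs`, `ys`: for every tree, every
valuation of the remaining variables, and every value of `xs`, there is at most one
value of `ys` satisfying `φ`. -/
def FunctionalIn {k : ℕ} (φ : TForm Sig rank k) (xs ys : Fin k → ℕ) : Prop :=
  ∀ (t : RTree Sig rank) (ν : ℕ → Pos t) (a b b' : Fin k → Pos t),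
    Sat t φ (updVec (updVec ν xs a) ys b) →
    Sat t φ (updVec (updVec ν xs a) ys b') → b = b'

/-- Well-formedness: in each transitive closure the `2k` bound variables are
pairwise distinct and occur free in the body. -/
def WF {k : ℕ} : TForm Sig rank k → Prop
  | .not φ => WF φ
  | .and φ ψ => WF φ ∧ WF ψ
  | .or φ ψ => WF φ ∧ WF ψ
  | .ex _ φ => WF φ
  | .all _ φ => WF φ
  | .tc xs ys φ _ _ =>
      Distinct2 xs ys ∧ (Set.range xs ∪ Set.range ys) ⊆ freeVars φ ∧ WF φ
  | _ => True

/-- All transitive closures occurring in the formula are deterministic, i.e., applied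
to functional formulas. -/
def DetTC {k : ℕ} : TForm Sig rank k → Prop
  | .not φ => DetTC φ
  | .and φ ψ => DetTC φ ∧ DetTC ψ
  | .or φ ψ => DetTC φ ∧ DetTC ψ
  | .ex _ φ => DetTC φ
  | .all _ φ => DetTC φ
  | .tc xs ys φ _ _ => FunctionalIn φ xs ys ∧ DetTC φ
  | _ => True

/-- All occurrences of transitive closure are positive (within the scope of an even
number of negations); the polarity parameter `b` is `true` for an even number. -/
def PosTC {k : ℕ} : Bool → TForm Sig rank k → Prop
  | b, .not φ => PosTC (!b) φ
  | b, .and φ ψ => PosTC b φ ∧ PosTC b ψ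
  | b, .or φ ψ => PosTC b φ ∧ PosTC b ψ
  | b, .ex _ φ => PosTC b φ
  | b, .all _ φ => PosTC b φ
  | b, .tc _ _ φ _ _ => b = true ∧ PosTC b φ
  | _, _ => True

/-- The formula contains no transitive closure operator (pure first-order). -/
def TCFree {k : ℕ} : TForm Sig rank k → Prop
  | .not φ => TCFree φ
  | .and φ ψ => TCFree φ ∧ TCFree ψ
  | .or φ ψ => TCFree φ ∧ TCFree ψ
  | .ex _ φ => TCFree φ
  | .all _ φ => TCFree φ
  | .tc _ _ _ _ _ => False
  | _ => True

/-- The tree language defined by a (closed) formula. -/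
def treesOf {k : ℕ} (φ : TForm Sig rank k) : Set (RTree Sig rank) :=
  {t | Sat t φ fun _ => rootPos t}

/-- `FO+DTC^k`: tree languages definable by closed first-order formulas with `k`-ary
deterministic transitive closure. -/
def FODTC (Sig : Type) (rank : Sig → ℕ) (k : ℕ) : Set (Set (RTree Sig rank)) :=
  {L | ∃ φ : TForm Sig rank k, WF φ ∧ DetTC φ ∧ freeVars φ = ∅ ∧ L = treesOf φ}

/-- `FO+TC^k`: tree languages definable by closed first-order formulas with `k`-ary
transitive closure. -/
def FOTC (Sig : Type) (rank : Sig → ℕ) (k : ℕ) : Set (Set (RTree Sig rank)) :=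
  {L | ∃ φ : TForm Sig rank k, WF φ ∧ freeVars φ = ∅ ∧ L = treesOf φ}

/-- `FO+posTC^k`: tree languages definable by closed first-order formulas in which
every occurrence of the `k`-ary transitive closure operator is positive. -/
def FOposTC (Sig : Type) (rank : Sig → ℕ) (k : ℕ) : Set (Set (RTree Sig rank)) :=
  {L | ∃ φ : TForm Sig rank k, WF φ ∧ PosTC true φ ∧ freeVars φ = ∅ ∧ L = treesOf φ}

/-!  ### k-head tree-walking automata with nested pebbles  -/

/-- Tests of a `k`-head tree-walking automaton with pebble set `X`:
label of the node under head `i`, presence of pebble `x` at head `i`, and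
child number of the node under head `i`. -/
inductive TTest (Sig : Type) (k : ℕ) (X : Type) : Type
  | lab (i : Fin k) (a : Sig)
  | peb (i : Fin k) (x : X)
  | chno (i : Fin k) (j : ℕ)

/-- Instructions: move head `i` up / down to the `j`-th child (1-based), drop a
pebble at head `i`, retrieve the most recently dropped pebble (from a distance),
or perform a positive (`b = true`) or negated (`b = false`) test. -/
inductive TInstr (Sig : Type) (k : ℕ) (X : Type) : Type
  | up (i : Fin k)
  | down (i : Fin k) (j : ℕ)
  | dropPeb (i : Fin k) (x : X)
  | retrieve (x : X)
  | test (b : Bool) (τ : TTest Sig k X)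

/-- A `k`-head tree-walking automaton with nested pebbles: a finite state set `Q`,
a finite pebble set `X`, an initial state, accepting states, and a finite set of
instructions `⟨p, χ, q⟩`. -/
structure TWA (Sig : Type) (rank : Sig → ℕ) (k : ℕ) : Type 1 where
  Q : Type
  finQ : Fintype Q
  X : Type
  finX : Fintype X
  q0 : Q
  acc : Set Q
  instr : Set (Q × TInstr Sig k X × Q)
  instrFin : instr.Finite

/-- Configurations: a state, the positions of the `k` heads, and the stack of
dropped pebbles with their positions (most recent first). -/
abbrev TConf {Sig : Type} {rank : Sig → ℕ} {k : ℕ} (A : TWA Sig rank k)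
    (t : RTree Sig rank) : Type :=
  A.Q × (Fin k → Pos t) × List (A.X × Pos t)

/-- Semantics of tests. -/
def testHolds {k : ℕ} (t : RTree Sig rank) {X : Type} (τ : TTest Sig k X)
    (hs : Fin k → Pos t) (π : List (X × Pos t)) : Prop :=
  match τ with
  | .lab i a => labelAt t (hs i).1 = some a
  | .peb i x => (x, hs i) ∈ π
  | .chno i j => childNo (hs i).1 = j

/-- Semantics of a single instruction, relating head positions and pebble stacks
before and after. -/
def instrStep {k : ℕ} (t : RTree Sig rank) {X : Type} (ins : TInstr Sig k X)
    (hs : Fin k → Pos t) (π : List (X × Pos t))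
    (hs' : Fin k → Pos t) (π' : List (X × Pos t)) : Prop :=
  match ins with
  | .up i => π' = π ∧ (∃ j : ℕ, (hs i).1 = (hs' i).1 ++ [j]) ∧ ∀ h, h ≠ i → hs' h = hs h
  | .down i j => π' = π ∧ 1 ≤ j ∧ (hs' i).1 = (hs i).1 ++ [j - 1] ∧ ∀ h, h ≠ i → hs' h = hs h
  | .dropPeb i x => hs' = hs ∧ π' = (x, hs i) :: π ∧ ∀ w, (x, w) ∉ π
  | .retrieve x => hs' = hs ∧ ∃ w, π = (x, w) :: π'
  | .test b τ => hs' = hs ∧ π' = π ∧ (testHolds t τ hs π ↔ b = true)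

/-- The step relation of automaton `A` on tree `t`. -/
def Step {k : ℕ} (A : TWA Sig rank k) (t : RTree Sig rank) :
    TConf A t → TConf A t → Prop :=
  fun c c' => ∃ ins : TInstr Sig k A.X,
    (c.1, ins, c'.1) ∈ A.instr ∧ instrStep t ins c.2.1 c.2.2 c'.2.1 c'.2.2

/-- `χ'` is the negation of the test `χ`. -/
def negOf {k : ℕ} {X : Type} (χ χ' : TInstr Sig k X) : Prop :=
  ∃ b τ, χ = TInstr.test b τ ∧ χ' = TInstr.test (!b) τ

/-- Determinism: any two distinct instructions with the same source state consist
of a test and its negation. -/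
def Deterministic {k : ℕ} (A : TWA Sig rank k) : Prop :=
  ∀ p χ₁ q₁ χ₂ q₂, (p, χ₁, q₁) ∈ A.instr → (p, χ₂, q₂) ∈ A.instr →
    (χ₁, q₁) ≠ (χ₂, q₂) → negOf χ₁ χ₂ ∨ negOf χ₂ χ₁

/-- The initial configuration: initial state, all heads at the root, no pebbles. -/
def initConf {k : ℕ} (A : TWA Sig rank k) (t : RTree Sig rank) : TConf A t :=
  (A.q0, fun _ => rootPos t, [])

/-- A configuration is halting if no step is possible from it. -/
def HaltingConf {k : ℕ} (A : TWA Sig rank k) (t : RTree Sig rank) (c : TConf A t) : Prop :=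
  ∀ c', ¬ Step A t c c'

/-- Acceptance: some computation from the initial configuration halts in an
accepting state with all heads at the root and no pebbles on the tree. -/
def Accepts {k : ℕ} (A : TWA Sig rank k) (t : RTree Sig rank) : Prop :=
  ∃ q ∈ A.acc,
    Relation.ReflTransGen (Step A t) (initConf A t) (q, fun _ => rootPos t, []) ∧
    HaltingConf A t (q, fun _ => rootPos t, [])

/-- The tree language accepted by `A`. -/
def Lang {k : ℕ} (A : TWA Sig rank k) : Set (RTree Sig rank) := {t | Accepts A t}

/-- The automaton uses no pebbles at all. -/
def PebbleFree {k : ℕ} (A : TWA Sig rank k) : Prop :=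
  ∀ p χ q, (p, χ, q) ∈ A.instr →
    (∀ i x, χ ≠ TInstr.dropPeb i x) ∧ (∀ x, χ ≠ TInstr.retrieve x) ∧
    (∀ b i x, χ ≠ TInstr.test b (TTest.peb i x))

/-- `DPTWA^k`: tree languages accepted by deterministic `k`-head tree-walking
automata with nested pebbles. -/
def DPTWA (Sig : Type) (rank : Sig → ℕ) (k : ℕ) : Set (Set (RTree Sig rank)) :=
  {L | ∃ A : TWA Sig rank k, Deterministic A ∧ L = Lang A}

/-- `NPTWA^k`: tree languages accepted by nondeterministic `k`-head tree-walking
automata with nested pebbles. -/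
def NPTWA (Sig : Type) (rank : Sig → ℕ) (k : ℕ) : Set (Set (RTree Sig rank)) :=
  {L | ∃ A : TWA Sig rank k, L = Lang A}

/-- `NTWA^k`: tree languages accepted by nondeterministic `k`-head tree-walking
automata without pebbles. -/
def NTWA (Sig : Type) (rank : Sig → ℕ) (k : ℕ) : Set (Set (RTree Sig rank)) :=
  {L | ∃ A : TWA Sig rank k, PebbleFree A ∧ L = Lang A}

end NestedPebbles

namespace NestedPebbles

/-- Head positions together with a pebble stack. -/
abbrev HCfg (k : ℕ) (X : Type) {Sig : Type} {rank : Sig → ℕ} (t : RTree Sig rank) : Type :=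
  (Fin k → Pos t) × List (X × Pos t)

/-- Relations on head/pebble configurations, uniformly in the tree. -/
abbrev CRel (Sig : Type) (rank : Sig → ℕ) (k : ℕ) (X : Type) : Type :=
  ∀ t : RTree Sig rank, HCfg k X t → HCfg k X t → Prop

/-- Step relation of a fragment given by a set of instructions. -/
def FStep {Sig : Type} {rank : Sig → ℕ} {k : ℕ} {X Q : Type}
    (E : Set (Q × TInstr Sig k X × Q)) (t : RTree Sig rank)
    (c c' : Q × HCfg k X t) : Prop :=
  ∃ ins : TInstr Sig k X, (c.1, ins, c'.1) ∈ E ∧ instrStep t ins c.2.1 c.2.2 c'.2.1 c'.2.2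

/-- `R` is computed by a finite automaton fragment. -/
def Realizable {Sig : Type} {rank : Sig → ℕ} {k : ℕ} {X : Type} (R : CRel Sig rank k X) : Prop :=
  ∃ (Q : Type) (_ : Finite Q) (E : Set (Q × TInstr Sig k X × Q)) (_ : E.Finite) (s f : Q),
    ∀ t c c', R t c c' ↔ Relation.ReflTransGen (FStep E t) (s, c) (f, c')

section Real
open Relation

variable {Sig : Type} {rank : Sig → ℕ} {k : ℕ} {X : Type}

theorem Realizable.congr {R S : CRel Sig rank k X} (hR : Realizable R)
    (h : ∀ t c c', S t c c' ↔ R t c c') : Realizable S := by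
  obtain ⟨Q, hQ, E, hE, s, f, H⟩ := hR
  exact ⟨Q, hQ, E, hE, s, f, fun t c c' => (h t c c').trans (H t c c')⟩

/-- An instruction set acting as an empty move. -/
def epsSet {Q : Type} (i : Fin k) (p q : Q) : Set (Q × TInstr Sig k X × Q) :=
  {(p, TInstr.test true (TTest.chno i 0), q), (p, TInstr.test false (TTest.chno i 0), q)}

theorem epsSet_finite {Q : Type} (i : Fin k) (p q : Q) :
    (epsSet (Sig := Sig) (X := X) i p q).Finite := by
  unfold epsSet; exact Set.toFinite _

theorem FStep_union {Q : Type} (E E' : Set (Q × TInstr Sig k X × Q)) (t : RTree Sig rank)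
    (c c' : Q × HCfg k X t) : FStep (E ∪ E') t c c' ↔ FStep E t c c' ∨ FStep E' t c c' := by
  simp only [FStep, Set.mem_union, or_and_right, exists_or]

theorem FStep_eps {Q : Type} (i : Fin k) (p q : Q) (t : RTree Sig rank)
    (c c' : Q × HCfg k X t) :
    FStep (epsSet (Sig := Sig) (X := X) i p q) t c c' ↔ c.1 = p ∧ c'.1 = q ∧ c'.2 = c.2 := by
  obtain ⟨a, hs, π⟩ := c
  obtain ⟨a', hs', π'⟩ := c'
  constructor
  · rintro ⟨ins, hm, hi⟩
    simp only [epsSet, Set.mem_insert_iff, Set.mem_singleton_iff, Prod.mk.injEq] at hm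
    rcases hm with ⟨rfl, rfl, rfl⟩ | ⟨rfl, rfl, rfl⟩ <;>
    · simp only [instrStep] at hi
      simp [hi.1, hi.2.1]
  · rintro ⟨rfl, rfl, h⟩
    simp only [Prod.mk.injEq] at h
    obtain ⟨rfl, rfl⟩ := h
    by_cases hc : childNo (hs' i).1 = 0
    · exact ⟨TInstr.test true (TTest.chno i 0), by simp [epsSet], by simp [instrStep, testHolds, hc]⟩
    · exact ⟨TInstr.test false (TTest.chno i 0), by simp [epsSet],
        by simp [instrStep, testHolds, hc]⟩

/-- Image of an instruction set under a map of states. -/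
def mapE {Q Q' : Type} (g : Q → Q') (E : Set (Q × TInstr Sig k X × Q)) :
    Set (Q' × TInstr Sig k X × Q') :=
  (fun e => (g e.1, e.2.1, g e.2.2)) '' E

theorem FStep_map {Q Q' : Type} (g : Q → Q') (E : Set (Q × TInstr Sig k X × Q))
    (t : RTree Sig rank) (c c' : Q' × HCfg k X t) :
    FStep (mapE g E) t c c' ↔ ∃ p q, c.1 = g p ∧ c'.1 = g q ∧ FStep E t (p, c.2) (q, c'.2) := by
  constructor
  · rintro ⟨ins, ⟨⟨p, i2, q⟩, he, heq⟩, hi⟩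
    simp only [Prod.mk.injEq] at heq
    obtain ⟨h1, rfl, h3⟩ := heq
    exact ⟨p, q, h1.symm, h3.symm, _, he, hi⟩
  · rintro ⟨p, q, h1, h2, ins, he, hi⟩
    exact ⟨ins, ⟨_, he, by simp [h1, h2]⟩, hi⟩

theorem Reach_map {Q Q' : Type} (g : Q → Q') (E : Set (Q × TInstr Sig k X × Q))
    (E' : Set (Q' × TInstr Sig k X × Q')) (hsub : mapE g E ⊆ E')
    (t : RTree Sig rank) (p q : Q) (c c' : HCfg k X t)
    (h : ReflTransGen (FStep E t) (p, c) (q, c')) :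
    ReflTransGen (FStep E' t) (g p, c) (g q, c') := by
  have key : ∀ d : Q × HCfg k X t, ReflTransGen (FStep E t) (p, c) d →
      ReflTransGen (FStep E' t) (g p, c) (g d.1, d.2) := by
    intro d hd
    induction hd with
    | refl => exact ReflTransGen.refl
    | @tail a b _ hab ih =>
      obtain ⟨ins, h3, h4⟩ := (FStep_map g E t (g a.1, a.2) (g b.1, b.2)).2 ⟨a.1, b.1, rfl, rfl, hab⟩
      exact ih.tail ⟨ins, hsub h3, h4⟩
  exact key _ h

theorem Realizable.instr (ins : TInstr Sig k X) :
    Realizable (rank := rank) (fun t c c' => instrStep t ins c.1 c.2 c'.1 c'.2) := by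
  refine ⟨Bool, inferInstance, {(false, ins, true)}, Set.finite_singleton _, false, true, ?_⟩
  intro t c c'
  constructor
  · intro h
    exact ReflTransGen.single ⟨ins, rfl, h⟩
  · intro h
    rcases ReflTransGen.cases_head h with h | ⟨⟨q, d⟩, ⟨i1, h1, h2⟩, h3⟩
    · simp at h
    · simp only [Set.mem_singleton_iff, Prod.mk.injEq] at h1
      obtain ⟨-, rfl, rfl⟩ := h1
      rcases ReflTransGen.cases_head h3 with h | ⟨⟨q, d⟩, ⟨i1, h1, h2⟩, h3⟩
      · simp only [Prod.mk.injEq, true_and] at h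
        subst h; exact h2
      · simp at h1

theorem Realizable.never : Realizable (Sig := Sig) (rank := rank) (k := k) (X := X)
    (fun _ _ _ => False) := by
  refine ⟨Bool, inferInstance, ∅, Set.finite_empty, false, true, ?_⟩
  intro t c c'
  simp only [false_iff]
  intro h
  rcases ReflTransGen.cases_head h with h | ⟨⟨q, d⟩, ⟨i1, h1, h2⟩, h3⟩
  · simp at h
  · simp at h1

theorem Realizable.seq (i0 : Fin k) {R S : CRel Sig rank k X} (hR : Realizable R)
    (hS : Realizable S) : Realizable (fun t c c' => ∃ m, R t c m ∧ S t m c') := by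
  obtain ⟨Q, hQ, E, hE, s, f, H⟩ := hR
  obtain ⟨Q', hQ', E', hE', s', f', H'⟩ := hS
  refine ⟨Q ⊕ Q', inferInstance, (mapE Sum.inl E ∪ mapE Sum.inr E') ∪ epsSet i0 (Sum.inl f)
    (Sum.inr s'), ((hE.image _).union (hE'.image _)).union (epsSet_finite _ _ _),
    Sum.inl s, Sum.inr f', ?_⟩
  intro t c c'
  constructor
  · rintro ⟨m, h1, h2⟩
    rw [H] at h1
    rw [H'] at h2
    refine (Reach_map Sum.inl E _ ?_ t _ _ _ _ h1).trans (ReflTransGen.head (b := (Sum.inr s', m))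
      ?_ (Reach_map Sum.inr E' _ ?_ t _ _ _ _ h2))
    · intro x hx; exact Or.inl (Or.inl hx)
    · rw [FStep_union, FStep_eps]; exact Or.inr ⟨rfl, rfl, rfl⟩
    · intro x hx; exact Or.inl (Or.inr hx)
  · intro h
    have key : ∀ d : (Q ⊕ Q') × HCfg k X t, ReflTransGen (FStep ((mapE Sum.inl E ∪ mapE Sum.inr E')
        ∪ epsSet i0 (Sum.inl f) (Sum.inr s')) t) (Sum.inl s, c) d →
        (∀ q, d.1 = Sum.inl q → ReflTransGen (FStep E t) (s, c) (q, d.2)) ∧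
        (∀ q, d.1 = Sum.inr q → ∃ m, R t c m ∧ ReflTransGen (FStep E' t) (s', m) (q, d.2)) := by
      intro d hd
      induction hd with
      | refl =>
        constructor
        · rintro q hq; cases hq; exact ReflTransGen.refl
        · rintro q hq; cases hq
      | @tail a b _ hst ih =>
        obtain ⟨a1, a2⟩ := a
        obtain ⟨b1, b2⟩ := b
        rw [FStep_union, FStep_union, FStep_eps, FStep_map, FStep_map] at hst
        rcases hst with (⟨p, q, h1, h2, h3⟩ | ⟨p, q, h1, h2, h3⟩) | ⟨h1, h2, h3⟩
        · simp only at h1 h2 h3 ih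
          subst h1 h2
          refine ⟨?_, ?_⟩
          · rintro q' hq'; cases hq'
            exact (ih.1 p rfl).tail h3
          · rintro q hq; cases hq
        · simp only at h1 h2 h3 ih
          subst h1 h2
          refine ⟨?_, ?_⟩
          · rintro q hq; cases hq
          · rintro q' hq'; cases hq'
            obtain ⟨m, hm, hm2⟩ := ih.2 p rfl
            exact ⟨m, hm, hm2.tail h3⟩
        · simp only at h1 h2 h3 ih
          subst h1 h2 h3
          refine ⟨?_, ?_⟩
          · rintro q hq; cases hq
          · rintro q' hq'; cases hq'
            exact ⟨_, (H _ _ _).2 (ih.1 f rfl), ReflTransGen.refl⟩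
    obtain ⟨m, h1, h2⟩ := (key _ h).2 f' rfl
    exact ⟨m, h1, (H' _ _ _).2 h2⟩

theorem Realizable.star (i0 : Fin k) {R : CRel Sig rank k X} (hR : Realizable R) :
    Realizable (fun t => ReflTransGen (R t)) := by
  obtain ⟨Q, hQ, E, hE, s, f, H⟩ := hR
  refine ⟨Option Q, inferInstance, (mapE some E ∪ epsSet i0 none (some s)) ∪ epsSet i0 (some f)
    none, ((hE.image _).union (epsSet_finite _ _ _)).union (epsSet_finite _ _ _),
    none, none, ?_⟩
  intro t c c'
  constructor
  · intro h
    induction h with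
    | refl => exact ReflTransGen.refl
    | @tail a b _ hst ih =>
      rw [H] at hst
      refine ih.trans (ReflTransGen.head (b := (some s, a)) ?_
        (ReflTransGen.tail (b := (some f, b)) (Reach_map some E _ ?_ t _ _ _ _ hst) ?_))
      · rw [FStep_union, FStep_union, FStep_eps]; exact Or.inl (Or.inr ⟨rfl, rfl, rfl⟩)
      · intro x hx; exact Or.inl (Or.inl hx)
      · rw [FStep_union, FStep_eps]; exact Or.inr ⟨rfl, rfl, rfl⟩
  · intro h
    have key : ∀ d : Option Q × HCfg k X t, ReflTransGen (FStep ((mapE some E ∪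
        epsSet i0 none (some s)) ∪ epsSet i0 (some f) none) t) (none, c) d →
        (∀ q, d.1 = some q → ∃ m, ReflTransGen (R t) c m ∧
          ReflTransGen (FStep E t) (s, m) (q, d.2)) ∧
        (d.1 = none → ReflTransGen (R t) c d.2) := by
      intro d hd
      induction hd with
      | refl =>
        constructor
        · rintro q hq; cases hq
        · rintro _; exact ReflTransGen.refl
      | @tail a b _ hst ih =>
        obtain ⟨a1, a2⟩ := a
        obtain ⟨b1, b2⟩ := b
        rw [FStep_union, FStep_union, FStep_eps, FStep_map, FStep_eps] at hst
        rcases hst with (⟨p, q, h1, h2, h3⟩ | ⟨h1, h2, h3⟩) | ⟨h1, h2, h3⟩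
        · simp only at h1 h2 h3 ih
          subst h1 h2
          refine ⟨?_, ?_⟩
          · rintro q' hq'; cases hq'
            obtain ⟨m, hm, hm2⟩ := ih.1 p rfl
            exact ⟨m, hm, hm2.tail h3⟩
          · rintro hq; cases hq
        · simp only at h1 h2 h3 ih
          subst h1 h2 h3
          refine ⟨?_, ?_⟩
          · rintro q' hq'; cases hq'
            exact ⟨_, ih.2 rfl, ReflTransGen.refl⟩
          · rintro hq; cases hq
        · simp only at h1 h2 h3 ih
          subst h1 h2 h3
          refine ⟨?_, ?_⟩
          · rintro q hq; cases hq
          · rintro _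
            obtain ⟨m, hm, hm2⟩ := ih.1 f rfl
            exact hm.tail ((H _ _ _).2 hm2)
    exact (key _ h).2 rfl

theorem Realizable.or (i0 : Fin k) {R S : CRel Sig rank k X} (hR : Realizable R)
    (hS : Realizable S) : Realizable (fun t c c' => R t c c' ∨ S t c c') := by
  obtain ⟨Q, hQ, E, hE, s, f, H⟩ := hR
  obtain ⟨Q', hQ', E', hE', s', f', H'⟩ := hS
  -- states: `inl`, `inr` copies, and new start `inr (inr false)`, final `inr (inr true)`
  let gl : Q → Q ⊕ Q' ⊕ Bool := Sum.inl
  let gr : Q' → Q ⊕ Q' ⊕ Bool := fun q => Sum.inr (Sum.inl q)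
  let st : Q ⊕ Q' ⊕ Bool := Sum.inr (Sum.inr false)
  let fn : Q ⊕ Q' ⊕ Bool := Sum.inr (Sum.inr true)
  let EE : Set ((Q ⊕ Q' ⊕ Bool) × TInstr Sig k X × (Q ⊕ Q' ⊕ Bool)) :=
    ((((mapE gl E ∪ mapE gr E') ∪ epsSet i0 st (gl s)) ∪ epsSet i0 st (gr s')) ∪
      epsSet i0 (gl f) fn) ∪ epsSet i0 (gr f') fn
  have hEE : ∀ t d d', FStep (rank := rank) EE t d d' ↔
      (((((∃ p q, d.1 = gl p ∧ d'.1 = gl q ∧ FStep E t (p, d.2) (q, d'.2)) ∨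
        (∃ p q, d.1 = gr p ∧ d'.1 = gr q ∧ FStep E' t (p, d.2) (q, d'.2))) ∨
        (d.1 = st ∧ d'.1 = gl s ∧ d'.2 = d.2)) ∨
        (d.1 = st ∧ d'.1 = gr s' ∧ d'.2 = d.2)) ∨
        (d.1 = gl f ∧ d'.1 = fn ∧ d'.2 = d.2)) ∨
        (d.1 = gr f' ∧ d'.1 = fn ∧ d'.2 = d.2) := by
    intro t d d'
    simp only [EE, FStep_union, FStep_eps, FStep_map]
  refine ⟨Q ⊕ Q' ⊕ Bool, inferInstance, EE,
    (((((hE.image _).union (hE'.image _)).union (epsSet_finite _ _ _)).union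
      (epsSet_finite _ _ _)).union (epsSet_finite _ _ _)).union (epsSet_finite _ _ _),
    st, fn, ?_⟩
  intro t c c'
  constructor
  · rintro (h | h)
    · rw [H] at h
      refine ReflTransGen.head (b := (gl s, c)) ?_
        (ReflTransGen.tail (b := (gl f, c')) (Reach_map gl E _ ?_ t _ _ _ _ h) ?_)
      · rw [hEE]; exact Or.inl (Or.inl (Or.inl (Or.inr ⟨rfl, rfl, rfl⟩)))
      · intro x hx; exact Or.inl (Or.inl (Or.inl (Or.inl (Or.inl hx))))
      · rw [hEE]; exact Or.inl (Or.inr ⟨rfl, rfl, rfl⟩)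
    · rw [H'] at h
      refine ReflTransGen.head (b := (gr s', c)) ?_
        (ReflTransGen.tail (b := (gr f', c')) (Reach_map gr E' _ ?_ t _ _ _ _ h) ?_)
      · rw [hEE]; exact Or.inl (Or.inl (Or.inr ⟨rfl, rfl, rfl⟩))
      · intro x hx; exact Or.inl (Or.inl (Or.inl (Or.inl (Or.inr hx))))
      · rw [hEE]; exact Or.inr ⟨rfl, rfl, rfl⟩
  · intro h
    have key : ∀ d : (Q ⊕ Q' ⊕ Bool) × HCfg k X t, ReflTransGen (FStep EE t) (st, c) d →
        (d.1 = st → d.2 = c) ∧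
        (∀ q, d.1 = gl q → ReflTransGen (FStep E t) (s, c) (q, d.2)) ∧
        (∀ q, d.1 = gr q → ReflTransGen (FStep E' t) (s', c) (q, d.2)) ∧
        (d.1 = fn → R t c d.2 ∨ S t c d.2) := by
      intro d hd
      induction hd with
      | refl => simp [st, gl, gr, fn]
      | @tail a b _ hst ih =>
        obtain ⟨a1, a2⟩ := a
        obtain ⟨b1, b2⟩ := b
        rw [hEE] at hst
        simp only at hst ih ⊢
        rcases hst with ((((⟨p, q, rfl, rfl, h3⟩ | ⟨p, q, rfl, rfl, h3⟩) | ⟨rfl, rfl, rfl⟩) |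
          ⟨rfl, rfl, rfl⟩) | ⟨rfl, rfl, rfl⟩) | ⟨rfl, rfl, rfl⟩
        · have := (ih.2.1 p rfl).tail h3
          simpa [st, gl, gr, fn] using this
        · have := (ih.2.2.1 p rfl).tail h3
          simpa [st, gl, gr, fn] using this
        · have := ih.1 rfl
          subst this
          simpa [st, gl, gr, fn] using ReflTransGen.refl
        · have := ih.1 rfl
          subst this
          simpa [st, gl, gr, fn] using ReflTransGen.refl
        · have := (H _ _ _).2 (ih.2.1 f rfl)
          simpa [st, gl, gr, fn] using Or.inl this
        · have := (H' _ _ _).2 (ih.2.2.1 f' rfl)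
          simpa [st, gl, gr, fn] using Or.inr this
    exact (key _ h).2.2.2 rfl

/-- From a realizable relation to an automaton. -/
theorem Realizable.exists_twa [Finite X] (i0 : Fin k) {R : CRel Sig rank k X}
    (hR : Realizable R) : ∃ A : TWA Sig rank k, ∀ t, Accepts A t ↔
      R t (fun _ => rootPos t, []) (fun _ => rootPos t, []) := by
  obtain ⟨Q, hQ, E, hE, s, f, H⟩ := hR
  let A : TWA Sig rank k :=
    { Q := Option Q
      finQ := Fintype.ofFinite _
      X := X
      finX := Fintype.ofFinite _
      q0 := some s
      acc := {none}
      instr := mapE some E ∪ epsSet i0 (some f) none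
      instrFin := (hE.image _).union (epsSet_finite _ _ _) }
  refine ⟨A, fun t => ?_⟩
  have hstep : ∀ c c', Step A t c c' ↔ FStep (mapE some E ∪ epsSet i0 (some f) none) t c c' :=
    fun c c' => Iff.rfl
  have hstep' : Step A t = FStep (mapE some E ∪ epsSet i0 (some f) none) t := rfl
  constructor
  · rintro ⟨q, hq, hr, -⟩
    have hq' : q = none := hq
    subst hq'
    rw [hstep'] at hr
    have key : ∀ d : Option Q × HCfg k X t, ReflTransGen (FStep (mapE some E ∪
        epsSet i0 (some f) none) t) (some s, (fun _ => rootPos t, [])) d →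
        (∀ q, d.1 = some q → ReflTransGen (FStep E t) (s, (fun _ => rootPos t, [])) (q, d.2)) ∧
        (d.1 = none → R t (fun _ => rootPos t, []) d.2) := by
      intro d hd
      induction hd with
      | refl =>
        constructor
        · rintro q hq; cases hq; exact ReflTransGen.refl
        · rintro hq; cases hq
      | @tail a b _ hst ih =>
        obtain ⟨a1, a2⟩ := a
        obtain ⟨b1, b2⟩ := b
        rw [FStep_union, FStep_eps, FStep_map] at hst
        simp only at hst ih
        rcases hst with ⟨p, q, rfl, rfl, h3⟩ | ⟨rfl, rfl, rfl⟩
        · simpa using (ih.1 p rfl).tail h3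
        · simpa using (H _ _ _).2 (ih.1 f rfl)
    exact (key _ hr).2 rfl
  · intro h
    rw [H] at h
    refine ⟨none, rfl, ?_, ?_⟩
    · rw [hstep']
      refine ReflTransGen.tail (b := (some f, (fun _ => rootPos t, [])))
        (Reach_map some E _ ?_ t _ _ _ _ h) ?_
      · intro x hx; exact Or.inl hx
      · rw [FStep_union, FStep_eps]; exact Or.inr ⟨rfl, rfl, rfl⟩
    · intro c' hc
      rw [hstep', FStep_union, FStep_eps, FStep_map] at hc
      simp at hc

theorem Realizable.biUnion (i0 : Fin k) {ι : Type} (R : ι → CRel Sig rank k X)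
    (hR : ∀ j, Realizable (R j)) (l : List ι) : Realizable (fun t c c' => ∃ j ∈ l, R j t c c') := by
  induction l with
  | nil => exact Realizable.never.congr (by simp)
  | cons j l ih => exact ((hR j).or i0 ih).congr (by simp)

theorem Realizable.skip (i0 : Fin k) :
    Realizable (Sig := Sig) (rank := rank) (k := k) (X := X) (fun _ c c' => c' = c) := by
  refine (Realizable.never.star i0).congr ?_
  intro t c c'
  constructor
  · rintro rfl; exact ReflTransGen.refl
  · intro h
    rcases ReflTransGen.cases_head h with h | ⟨_, h, _⟩
    · exact h.symm
    · exact h.elim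

end Real
section Walks
open Relation

variable {Sig : Type} {rank : Sig → ℕ} {k : ℕ} {X : Type}

/-- Relations between positions of one head, depending on the pebble stack. -/
abbrev PRel (Sig : Type) (rank : Sig → ℕ) (X : Type) : Type :=
  ∀ t : RTree Sig rank, List (X × Pos t) → Pos t → Pos t → Prop

/-- Lift a relation on positions of head `i` to configurations. -/
def HRel (i : Fin k) (r : PRel Sig rank X) : CRel Sig rank k X := fun t c c' =>
  c'.2 = c.2 ∧ r t c.2 (c.1 i) (c'.1 i) ∧ ∀ h, h ≠ i → c'.1 h = c.1 h

/-- `r` can be performed by head `i`. -/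
def Walk (i : Fin k) (r : PRel Sig rank X) : Prop := Realizable (HRel i r)

theorem Walk.congr {i : Fin k} {r s : PRel Sig rank X} (hr : Walk i r)
    (h : ∀ t π u u', s t π u u' ↔ r t π u u') : Walk i s :=
  Realizable.congr hr (fun t c c' => by simp [HRel, h])

theorem Walk.seq {i : Fin k} {r s : PRel Sig rank X} (hr : Walk i r) (hs : Walk i s) :
    Walk i (fun t π u u' => ∃ m, r t π u m ∧ s t π m u') := by
  refine (Realizable.seq i hr hs).congr ?_
  rintro t ⟨h, π⟩ ⟨h', π'⟩
  simp only [HRel]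
  constructor
  · rintro ⟨rfl, ⟨m, h1, h2⟩, h3⟩
    refine ⟨(Function.update h i m, π'), ⟨rfl, by simpa using h1, ?_⟩, rfl, by simpa using h2, ?_⟩
    · intro j hj; simp [hj]
    · intro j hj; simp [hj, h3]
  · rintro ⟨⟨m, π2⟩, ⟨h1, h2, h3⟩, h4, h5, h6⟩
    simp only at h1 h2 h3 h4 h5 h6
    subst h1 h4
    exact ⟨rfl, ⟨_, h2, h5⟩, fun j hj => (h6 j hj).trans (h3 j hj)⟩

theorem Walk.or {i : Fin k} {r s : PRel Sig rank X} (hr : Walk i r) (hs : Walk i s) :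
    Walk i (fun t π u u' => r t π u u' ∨ s t π u u') :=
  (Realizable.or i hr hs).congr (fun t c c' => by simp only [HRel]; tauto)

theorem Walk.never {i : Fin k} : Walk i (fun (_ : RTree Sig rank) (_ : List (X × _)) _ _ => False) :=
  Realizable.never.congr (fun t c c' => by simp [HRel])

theorem Walk.biUnion {i : Fin k} {ι : Type} (r : ι → PRel Sig rank X)
    (hr : ∀ j, Walk i (r j)) (l : List ι) : Walk i (fun t π u u' => ∃ j ∈ l, r j t π u u') := by
  induction l with
  | nil => exact Walk.never.congr (by simp)
  | cons j l ih => exact ((hr j).or ih).congr (by simp)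

theorem Walk.star {i : Fin k} {r : PRel Sig rank X} (hr : Walk i r) :
    Walk i (fun t π => ReflTransGen (r t π)) := by
  refine (Realizable.star i hr).congr ?_
  rintro t ⟨h, π⟩ c'
  constructor
  · obtain ⟨h', π'⟩ := c'
    rintro ⟨h1, h2, h3⟩
    simp only at h1 h2 h3
    subst h1
    have key : ∀ w, ReflTransGen (r t π') (h i) w →
        ReflTransGen (HRel i r t) (h, π') (Function.update h i w, π') := by
      intro w hw
      induction hw with
      | refl => simpa using ReflTransGen.refl
      | @tail a b _ hab ih =>
        refine ih.tail ⟨rfl, by simpa using hab, ?_⟩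
        intro j hj; simp [hj]
    have : h' = Function.update h i (h' i) := by
      funext j
      by_cases hj : j = i
      · subst hj; simp
      · simp [hj, h3]
    rw [this]
    exact key _ h2
  · intro hh
    induction hh with
    | refl => exact ⟨rfl, ReflTransGen.refl, fun _ _ => rfl⟩
    | @tail a b _ hab ih =>
      obtain ⟨a1, a2⟩ := a
      obtain ⟨b1, b2⟩ := b
      obtain ⟨h1, h2, h3⟩ := ih
      obtain ⟨h4, h5, h6⟩ := hab
      simp only at h1 h2 h3 h4 h5 h6
      subst h1 h4
      exact ⟨rfl, h2.tail h5, fun j hj => (h6 j hj).trans (h3 j hj)⟩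

theorem Walk.up (i : Fin k) : Walk i (fun (t : RTree Sig rank) (_ : List (X × Pos t)) u u' =>
    ∃ j : ℕ, u.1 = u'.1 ++ [j]) :=
  (Realizable.instr (TInstr.up i)).congr (fun t c c' => by simp [HRel, instrStep])

theorem Walk.down (i : Fin k) (j : ℕ) :
    Walk i (fun (t : RTree Sig rank) (_ : List (X × Pos t)) u u' => u'.1 = u.1 ++ [j]) :=
  (Realizable.instr (TInstr.down i (j + 1))).congr (fun t c c' => by simp [HRel, instrStep])

theorem HRel_same (i : Fin k) {t : RTree Sig rank} (c c' : HCfg k X t) (p : Prop) :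
    (c'.2 = c.2 ∧ (c'.1 i = c.1 i ∧ p) ∧ ∀ h, h ≠ i → c'.1 h = c.1 h) ↔
      (c'.1 = c.1 ∧ c'.2 = c.2 ∧ p) := by
  constructor
  · rintro ⟨h1, ⟨h2, hp⟩, h3⟩
    refine ⟨?_, h1, hp⟩
    funext j
    by_cases hj : j = i
    · subst hj; exact h2
    · exact h3 j hj
  · rintro ⟨h1, h2, hp⟩
    exact ⟨h2, ⟨congrFun h1 i, hp⟩, fun h _ => congrFun h1 h⟩

theorem Walk.lab (i : Fin k) (b : Bool) (a : Sig) :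
    Walk i (fun (t : RTree Sig rank) (_ : List (X × Pos t)) u u' =>
      u' = u ∧ (labelAt t u.1 = some a ↔ b = true)) :=
  (Realizable.instr (TInstr.test b (TTest.lab i a))).congr
    (fun t c c' => by simp only [HRel, instrStep, testHolds]; exact HRel_same i c c' _)

theorem Walk.peb (i : Fin k) (b : Bool) (x : X) :
    Walk i (fun (t : RTree Sig rank) (π : List (X × Pos t)) u u' =>
      u' = u ∧ ((x, u) ∈ π ↔ b = true)) :=
  (Realizable.instr (TInstr.test b (TTest.peb i x))).congr
    (fun t c c' => by simp only [HRel, instrStep, testHolds]; exact HRel_same i c c' _)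

theorem Walk.chno (i : Fin k) (b : Bool) (j : ℕ) :
    Walk i (fun (t : RTree Sig rank) (_ : List (X × Pos t)) u u' =>
      u' = u ∧ (childNo u.1 = j ↔ b = true)) :=
  (Realizable.instr (TInstr.test b (TTest.chno i j))).congr
    (fun t c c' => by simp only [HRel, instrStep, testHolds]; exact HRel_same i c c' _)

/-! Positions. -/

theorem subtree_append (t : RTree Sig rank) (p q : List ℕ) :
    t.subtree (p ++ q) = (t.subtree p).bind (fun s => s.subtree q) := by
  induction p generalizing t with
  | nil => simp [RTree.subtree]
  | cons i p ih =>
    simp only [List.cons_append, RTree.subtree]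
    cases t.child i with
    | none => rfl
    | some s => simp [ih]

theorem isPos_snoc (t : RTree Sig rank) (p : List ℕ) (j : ℕ) :
    IsPos t (p ++ [j]) ↔ ∃ a, labelAt t p = some a ∧ j < rank a := by
  unfold IsPos labelAt
  rw [subtree_append]
  cases t.subtree p with
  | none => simp
  | some s =>
    cases s with
    | node a c =>
      by_cases h : j < rank a <;> simp [RTree.subtree, RTree.child, RTree.label, h]

theorem isPos_prefix (t : RTree Sig rank) {p q : List ℕ} (h : p <+: q) (hq : IsPos t q) :
    IsPos t p := by
  obtain ⟨r, rfl⟩ := h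
  unfold IsPos at *
  rw [subtree_append] at hq
  cases h : t.subtree p with
  | none => simp [h] at hq
  | some s => rfl

theorem labelAt_isSome (t : RTree Sig rank) (u : Pos t) : ∃ a, labelAt t u.1 = some a := by
  obtain ⟨p, hp⟩ := u
  unfold IsPos at hp
  unfold labelAt
  obtain ⟨s, hs⟩ := Option.isSome_iff_exists.1 hp
  exact ⟨s.label, by simp [hs]⟩

theorem childNo_snoc (p : List ℕ) (j : ℕ) : childNo (p ++ [j]) = j + 1 := by
  simp [childNo]

theorem childNo_eq_zero (p : List ℕ) : childNo p = 0 ↔ p = [] := by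
  rcases List.eq_nil_or_concat p with rfl | ⟨q, j, rfl⟩
  · simp [childNo]
  · simp [childNo]

theorem exists_rank_bound [Fintype Sig] (rank : Sig → ℕ) : ∃ M, ∀ a, rank a ≤ M :=
  ⟨Finset.univ.sup rank, fun a => Finset.le_sup (Finset.mem_univ a)⟩

/-- A head can go anywhere. -/
theorem Walk.wander [Fintype Sig] (i : Fin k) :
    Walk i (fun (t : RTree Sig rank) (_ : List (X × Pos t)) _ _ => True) := by
  obtain ⟨M, hM⟩ := exists_rank_bound rank
  refine (((Walk.up i).star).seq ((Walk.biUnion _ (fun j => Walk.down i j) (List.range M)).star)).congr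
    ?_
  intro t π u u'
  simp only [true_iff]
  refine ⟨rootPos t, ?_, ?_⟩
  · obtain ⟨p, hp⟩ := u
    induction p using List.reverseRecOn with
    | nil => exact ReflTransGen.refl
    | append_singleton p j ih =>
      have hp' := isPos_prefix t (List.prefix_append p [j]) hp
      exact ReflTransGen.head ⟨j, rfl⟩ (ih hp')
  · obtain ⟨p, hp⟩ := u'
    induction p using List.reverseRecOn with
    | nil => exact ReflTransGen.refl
    | append_singleton p j ih =>
      have hp' := isPos_prefix t (List.prefix_append p [j]) hp
      refine ReflTransGen.tail (ih hp') ⟨j, ?_, rfl⟩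
      obtain ⟨a, _, ha⟩ := (isPos_snoc t p j).1 hp
      exact List.mem_range.2 (lt_of_lt_of_le ha (hM a))

/-- Walk a head to a pebble. -/
theorem Walk.goto [Fintype Sig] (i : Fin k) (x : X) :
    Walk i (fun (t : RTree Sig rank) (π : List (X × Pos t)) _ u' => (x, u') ∈ π) :=
  ((Walk.wander i).seq (Walk.peb i true x)).congr (by
    intro t π u u'
    simp)

/-- Independent walks of all the heads. -/
theorem Realizable.allHeads (i0 : Fin k) (r : Fin k → PRel Sig rank X) (hr : ∀ i, Walk i (r i)) :
    Realizable (fun t (c c' : HCfg k X t) => c'.2 = c.2 ∧ ∀ i, r i t c.2 (c.1 i) (c'.1 i)) := by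
  have key : ∀ l : List (Fin k), l.Nodup → Realizable (fun t (c c' : HCfg k X t) => c'.2 = c.2 ∧
      (∀ i ∈ l, r i t c.2 (c.1 i) (c'.1 i)) ∧ ∀ i, i ∉ l → c'.1 i = c.1 i) := by
    intro l
    induction l with
    | nil =>
      intro _
      refine (Realizable.skip i0).congr ?_
      rintro t ⟨h, π⟩ ⟨h', π'⟩
      simp only [List.not_mem_nil, false_imp_iff, implies_true, not_false_eq_true, true_imp_iff,
        true_and, Prod.mk.injEq]
      rw [and_comm, funext_iff]
    | cons j l ih =>
      intro hnd
      rw [List.nodup_cons] at hnd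
      refine (Realizable.seq i0 (hr j) (ih hnd.2)).congr ?_
      rintro t ⟨h, π⟩ ⟨h', π'⟩
      constructor
      · rintro ⟨h1, h2, h3⟩
        simp only at h1 h2 h3
        subst h1
        refine ⟨(Function.update h j (h' j), π'), ⟨rfl, ?_, ?_⟩, rfl, ?_, ?_⟩
        · simpa using h2 j (by simp)
        · intro i hi; simp [hi]
        · intro i hi
          have : i ≠ j := by rintro rfl; exact hnd.1 hi
          simpa [this] using h2 i (by simp [hi])
        · intro i hi
          by_cases hij : i = j
          · subst hij; simp
          · simp [hij, h3 i (by simp [hi, hij])]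
      · rintro ⟨⟨m, π2⟩, ⟨h1, h2, h3⟩, h4, h5, h6⟩
        simp only at h1 h2 h3 h4 h5 h6
        subst h1 h4
        refine ⟨rfl, ?_, ?_⟩
        · intro i hi
          by_cases hij : i = j
          · subst hij
            simpa [h6 i hnd.1] using h2
          · have hl : i ∈ l := by simpa [hij] using hi
            simpa [h3 i hij] using h5 i hl
        · intro i hi
          simp only [List.mem_cons, not_or] at hi
          exact (h6 i hi.2).trans (h3 i hi.1)
  exact (key _ (List.nodup_finRange k)).congr (by simp)

theorem Realizable.wanderAll [Fintype Sig] (i0 : Fin k) :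
    Realizable (fun (t : RTree Sig rank) (c c' : HCfg k X t) => c'.2 = c.2) :=
  (Realizable.allHeads i0 _ (fun i => Walk.wander i)).congr (by simp)

theorem Realizable.gotoAll [Fintype Sig] (i0 : Fin k) (q : Fin k → X) :
    Realizable (fun (t : RTree Sig rank) (c c' : HCfg k X t) =>
      c'.2 = c.2 ∧ ∀ i, (q i, c'.1 i) ∈ c.2) :=
  Realizable.allHeads i0 _ (fun i => Walk.goto i (q i))

theorem Realizable.checkAll (i0 : Fin k) (q : Fin k → X) :
    Realizable (fun (t : RTree Sig rank) (c c' : HCfg k X t) =>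
      c' = c ∧ ∀ i, (q i, c.1 i) ∈ c.2) :=
  (Realizable.allHeads i0 _ (fun i => Walk.peb i true (q i))).congr (by
    rintro t ⟨h, π⟩ ⟨h', π'⟩
    simp only [Prod.mk.injEq, funext_iff, iff_true, forall_and]
    tauto)

/-- Drop pebbles `q i` at heads `i`, for `i` in `l` (last one first). -/
theorem Realizable.dropL (i0 : Fin k) (q : Fin k → X) (hq : Function.Injective q)
    (l : List (Fin k)) (hl : l.Nodup) :
    ∃ R : CRel Sig rank k X, Realizable R ∧ ∀ t h π, (∀ i w, (q i, w) ∉ π) →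
      ∀ c', R t (h, π) c' ↔ c' = (h, l.map (fun i => (q i, h i)) ++ π) := by
  induction l with
  | nil => exact ⟨_, Realizable.skip i0, by simp⟩
  | cons j l ih =>
    rw [List.nodup_cons] at hl
    obtain ⟨R, hR, H⟩ := ih hl.2
    refine ⟨_, Realizable.seq i0 hR (Realizable.instr (TInstr.dropPeb j (q j))), ?_⟩
    rintro t h π hf ⟨h', π'⟩
    simp only [H t h π hf, exists_eq_left, instrStep, Prod.mk.injEq, List.map_cons, List.cons_append]
    constructor
    · rintro ⟨rfl, rfl, -⟩; simp
    · rintro ⟨rfl, rfl⟩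
      refine ⟨rfl, rfl, ?_⟩
      intro w hw
      simp only [List.mem_append, List.mem_map, Prod.mk.injEq] at hw
      rcases hw with ⟨i, hi, h1, _⟩ | hw
      · exact hl.1 (hq h1 ▸ hi)
      · exact hf _ _ hw

theorem Realizable.retrieveL (i0 : Fin k) (q : Fin k → X) (l : List (Fin k)) :
    ∃ R : CRel Sig rank k X, Realizable R ∧ ∀ t h (g : Fin k → Pos t) π,
      ∀ c', R t (h, l.map (fun i => (q i, g i)) ++ π) c' ↔ c' = (h, π) := by
  induction l with
  | nil => exact ⟨_, Realizable.skip i0, by simp⟩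
  | cons j l ih =>
    obtain ⟨R, hR, H⟩ := ih
    refine ⟨_, Realizable.seq i0 (Realizable.instr (TInstr.retrieve (q j))) hR, ?_⟩
    rintro t h g π ⟨h', π'⟩
    rw [← H t h g π]
    simp only [instrStep, List.map_cons, List.cons_append]
    constructor
    · rintro ⟨⟨m1, m2⟩, ⟨h1, w, h2⟩, h3⟩
      simp only [List.cons.injEq] at h1 h2
      rw [h2.2, ← h1]; exact h3
    · intro h3
      exact ⟨_, ⟨rfl, _, rfl⟩, h3⟩

end Walks
section Traverse
open Relation

variable {Sig : Type} {rank : Sig → ℕ} {k : ℕ} {X : Type}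

theorem lex_snoc_zero (v u : List ℕ) (h : v < u ++ [0]) : v ≤ u := by
  induction u generalizing v with
  | nil =>
    cases v with
    | nil => exact le_refl _
    | cons a v =>
      simp [List.cons_lt_cons_iff] at h
  | cons b u ih =>
    cases v with
    | nil => exact le_of_lt (List.nil_lt_cons b u)
    | cons a v =>
      rw [List.cons_append, List.cons_lt_cons_iff] at h
      rcases h with h | ⟨rfl, h⟩
      · exact le_of_lt (List.cons_lt_cons_iff.2 (Or.inl h))
      · rcases lt_or_eq_of_le (ih v h) with h | rfl
        · exact le_of_lt (List.cons_lt_cons_iff.2 (Or.inr ⟨rfl, h⟩))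
        · exact le_refl _

theorem lex_snoc_succ (v u : List ℕ) (j : ℕ) (h : v < u ++ [j + 1]) :
    v < u ++ [j] ∨ u ++ [j] <+: v := by
  induction u generalizing v with
  | nil =>
    cases v with
    | nil => exact Or.inl (List.nil_lt_cons _ _)
    | cons a v =>
      simp only [List.nil_append, List.cons_lt_cons_iff, List.not_lt_nil, and_false, or_false] at h
      rcases Nat.lt_succ_iff_lt_or_eq.1 h with h | rfl
      · exact Or.inl (List.cons_lt_cons_iff.2 (Or.inl h))
      · exact Or.inr ⟨v, rfl⟩
  | cons b u ih =>
    cases v with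
    | nil => exact Or.inl (List.nil_lt_cons _ _)
    | cons a v =>
      rw [List.cons_append, List.cons_lt_cons_iff] at h
      rcases h with h | ⟨rfl, h⟩
      · exact Or.inl (List.cons_lt_cons_iff.2 (Or.inl h))
      · rcases ih v h with h | h
        · exact Or.inl (List.cons_lt_cons_iff.2 (Or.inr ⟨rfl, h⟩))
        · exact Or.inr (by simpa using h)

theorem lex_snoc_lt (u v : List ℕ) (j : ℕ) (h : v < u) : v < u ++ [j] := by
  induction u generalizing v with
  | nil => simp at h
  | cons b u ih =>
    cases v with
    | nil => exact List.nil_lt_cons _ _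
    | cons a v =>
      rw [List.cons_lt_cons_iff] at h
      rw [List.cons_append, List.cons_lt_cons_iff]
      rcases h with h | ⟨rfl, h⟩
      · exact Or.inl h
      · exact Or.inr ⟨rfl, ih v h⟩

theorem lex_append_lt (u a b : List ℕ) (h : a < b) : u ++ a < u ++ b := by
  induction u with
  | nil => simpa using h
  | cons c u ih =>
    rw [List.cons_append, List.cons_append, List.cons_lt_cons_iff]
    exact Or.inr ⟨rfl, ih⟩

/-- `u` is a leaf. -/
def isLeaf (t : RTree Sig rank) (u : Pos t) : Prop := ∃ a, labelAt t u.1 = some a ∧ rank a = 0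

/-- `u` is the last child of `u'`. -/
def lastUp (t : RTree Sig rank) (u u' : Pos t) : Prop :=
  ∃ a j, labelAt t u'.1 = some a ∧ u.1 = u'.1 ++ [j] ∧ rank a = j + 1

/-- `u'` is the next sibling of `u`. -/
def sib (t : RTree Sig rank) (u u' : Pos t) : Prop :=
  ∃ p j, u.1 = p ++ [j] ∧ u'.1 = p ++ [j + 1]

/-- `u'` is the successor of `u` in document order. -/
def nextPos (t : RTree Sig rank) (u u' : Pos t) : Prop :=
  u'.1 = u.1 ++ [0] ∨ (isLeaf t u ∧ ∃ m, ReflTransGen (lastUp t) u m ∧ sib t m u')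

/-- `u` is the last node in document order. -/
def isLast (t : RTree Sig rank) (u : Pos t) : Prop :=
  isLeaf t u ∧ ReflTransGen (lastUp t) u (rootPos t)

theorem isLeaf_prefix {t : RTree Sig rank} {u v : Pos t} (hu : isLeaf t u) (h : u.1 <+: v.1) :
    v = u := by
  obtain ⟨r, hr⟩ := h
  cases r with
  | nil => exact Subtype.ext (by simpa using hr.symm)
  | cons j r =>
    exfalso
    have : IsPos t (u.1 ++ [j]) := by
      refine isPos_prefix t ?_ v.2
      exact ⟨r, by simpa using hr⟩
    obtain ⟨a, ha, ha'⟩ := (isPos_snoc _ _ _).1 this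
    obtain ⟨b, hb, hb'⟩ := hu
    rw [ha] at hb
    cases hb
    omega

theorem trav_done {t : RTree Sig rank} {ok : Pos t → Prop} {u m : Pos t}
    (hu : isLeaf t u) (hv : ∀ v : Pos t, v.1 ≤ u.1 → ok v) (h : ReflTransGen (lastUp t) u m) :
    ∀ v : Pos t, (v.1 < m.1 ∨ m.1 <+: v.1) → ok v := by
  induction h with
  | refl =>
    rintro v (h | h)
    · exact hv v (le_of_lt h)
    · rw [isLeaf_prefix hu h]; exact hv u (le_refl _)
  | @tail m m' _ hm ih =>
    obtain ⟨a, j, h1, h2, h3⟩ := hm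
    rintro v (h | ⟨r, hr⟩)
    · refine ih v (Or.inl ?_)
      rw [h2]; exact lex_snoc_lt _ _ _ h
    · cases r with
      | nil =>
        refine ih v (Or.inl ?_)
        rw [h2, ← hr]
        exact lex_append_lt _ _ _ (List.nil_lt_cons _ _)
      | cons i r =>
        have : IsPos t (m'.1 ++ [i]) := isPos_prefix t ⟨r, by simpa using hr⟩ v.2
        obtain ⟨b, hb, hb'⟩ := (isPos_snoc _ _ _).1 this
        rw [h1] at hb
        cases hb
        have : i < j ∨ i = j := by omega
        rcases this with hij | rfl
        · refine ih v (Or.inl ?_)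
          rw [h2, ← hr]
          exact lex_append_lt _ _ _ (List.cons_lt_cons_iff.2 (Or.inl hij))
        · refine ih v (Or.inr ?_)
          rw [h2]
          exact ⟨r, by simpa using hr⟩

theorem trav_sound {t : RTree Sig rank} {ok : Pos t → Prop} {w : Pos t} (h0 : ok (rootPos t))
    (h : ReflTransGen (fun u u' => nextPos t u u' ∧ ok u') (rootPos t) w) (hw : isLast t w) :
    ∀ v, ok v := by
  have key : ∀ v : Pos t, v.1 ≤ w.1 → ok v := by
    clear hw
    induction h with
    | refl =>
      intro v hv
      have : v.1 = [] := by
        cases hv1 : v.1 with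
        | nil => rfl
        | cons a l =>
          rw [hv1] at hv
          exact absurd (List.nil_lt_cons a l) (not_lt_of_ge hv)
      have : v = rootPos t := Subtype.ext this
      rw [this]; exact h0
    | @tail a b _ hab ih =>
      intro v hv
      rcases lt_or_eq_of_le hv with hv | hv
      · rcases hab.1 with h | ⟨hl, m, hm, p, j, h1, h2⟩
        · rw [h] at hv
          exact ih v (lex_snoc_zero _ _ hv)
        · refine trav_done hl ih hm v ?_
          rw [h2] at hv
          rw [h1]
          exact lex_snoc_succ _ _ _ hv
      · rw [show v = b from Subtype.ext hv]; exact hab.2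
  intro v
  exact trav_done hw.1 key hw.2 v (Or.inr (by simp [rootPos]))

theorem trav_complete_aux (t s : RTree Sig rank) (u : Pos t) (hs : t.subtree u.1 = some s) :
    ∃ w, ReflTransGen (nextPos t) u w ∧ isLeaf t w ∧ ReflTransGen (lastUp t) w u := by
  induction s generalizing u with
  | node a c ih =>
    have hla : labelAt t u.1 = some a := by simp [labelAt, hs, RTree.label]
    by_cases ha : rank a = 0
    · exact ⟨u, ReflTransGen.refl, ⟨a, hla, ha⟩, ReflTransGen.refl⟩
    · have hpos : ∀ j, j < rank a → IsPos t (u.1 ++ [j]) :=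
        fun j hj => (isPos_snoc _ _ _).2 ⟨a, hla, hj⟩
      have hsub : ∀ j (hj : j < rank a), t.subtree (u.1 ++ [j]) = some (c ⟨j, hj⟩) := by
        intro j hj
        rw [subtree_append, hs]
        simp [RTree.subtree, RTree.child, hj]
      have key : ∀ j (hj : j < rank a), ∃ w, ReflTransGen (nextPos t) u w ∧ isLeaf t w ∧
          ReflTransGen (lastUp t) w ⟨u.1 ++ [j], hpos j hj⟩ := by
        intro j
        induction j with
        | zero =>
          intro hj
          obtain ⟨w, h1, h2, h3⟩ := ih ⟨0, hj⟩ ⟨u.1 ++ [0], hpos 0 hj⟩ (hsub 0 hj)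
          exact ⟨w, ReflTransGen.head (Or.inl rfl) h1, h2, h3⟩
        | succ j ihj =>
          intro hj
          obtain ⟨w, h1, h2, h3⟩ := ihj (by omega)
          obtain ⟨w', h1', h2', h3'⟩ := ih ⟨j + 1, hj⟩ ⟨u.1 ++ [j + 1], hpos _ hj⟩ (hsub _ hj)
          refine ⟨w', (h1.tail ?_).trans h1', h2', h3'⟩
          exact Or.inr ⟨h2, _, h3, u.1, j, rfl, rfl⟩
      obtain ⟨w, h1, h2, h3⟩ := key (rank a - 1) (by omega)
      exact ⟨w, h1, h2, h3.tail ⟨a, rank a - 1, hla, rfl, by omega⟩⟩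

theorem trav_complete (t : RTree Sig rank) :
    ∃ w, ReflTransGen (nextPos t) (rootPos t) w ∧ isLast t w := by
  obtain ⟨w, h1, h2, h3⟩ := trav_complete_aux t t (rootPos t) rfl
  exact ⟨w, h1, h2, h3⟩

theorem Walk.root (i : Fin k) [Fintype Sig] :
    Walk i (fun (t : RTree Sig rank) (_ : List (X × Pos t)) _ u' => u' = rootPos t) :=
  ((Walk.wander i).seq (Walk.chno i true 0)).congr (by
    intro t π u u'
    simp only [true_and, exists_eq_left', iff_true, childNo_eq_zero]
    exact Subtype.ext_iff)

theorem Walk.leaf (i : Fin k) [Fintype Sig] :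
    Walk i (fun (t : RTree Sig rank) (_ : List (X × Pos t)) u u' => u' = u ∧ isLeaf t u) := by
  classical
  refine (Walk.biUnion _ (fun a => Walk.lab i true a)
    (Finset.univ.filter (fun a => rank a = 0)).toList).congr ?_
  intro t π u u'
  simp only [isLeaf, Finset.mem_toList, Finset.mem_filter, Finset.mem_univ, true_and, iff_true]
  grind

theorem Walk.lastUp (i : Fin k) [Fintype Sig] :
    Walk i (fun (t : RTree Sig rank) (_ : List (X × Pos t)) u u' => lastUp t u u') := by
  refine (Walk.biUnion _ (fun a => ((Walk.chno i true (rank a)).seq (Walk.up i)).seq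
    (Walk.lab i true a)) Finset.univ.toList).congr ?_
  intro t π u u'
  simp only [NestedPebbles.lastUp, Finset.mem_toList, Finset.mem_univ, true_and, iff_true]
  constructor
  · rintro ⟨a, j, h1, h2, h3⟩
    refine ⟨a, u', ⟨u, ⟨rfl, ?_⟩, j, h2⟩, rfl, h1⟩
    rw [h2, childNo_snoc, h3]
  · rintro ⟨a, m, ⟨m', ⟨rfl, h1⟩, j, h2⟩, rfl, h3⟩
    refine ⟨a, j, h3, h2, ?_⟩
    rw [← h1, h2, childNo_snoc]

theorem Walk.sib (i : Fin k) [Fintype Sig] :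
    Walk i (fun (t : RTree Sig rank) (_ : List (X × Pos t)) u u' => sib t u u') := by
  obtain ⟨M, hM⟩ := exists_rank_bound rank
  refine (Walk.biUnion _ (fun j => ((Walk.chno i true (j + 1)).seq (Walk.up i)).seq
    (Walk.down i (j + 1))) (List.range M)).congr ?_
  intro t π u u'
  simp only [NestedPebbles.sib, List.mem_range, iff_true]
  constructor
  · rintro ⟨p, j, h1, h2⟩
    have hu := u.2
    rw [h1] at hu
    obtain ⟨a, _, ha⟩ := (isPos_snoc _ _ _).1 hu
    refine ⟨j, lt_of_lt_of_le ha (hM a), ⟨p, isPos_prefix t (List.prefix_append p [j]) hu⟩,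
      ⟨u, ⟨rfl, ?_⟩, j, h1⟩, h2⟩
    rw [h1, childNo_snoc]
  · rintro ⟨j, _, m, ⟨m', ⟨rfl, h1⟩, j', h2⟩, h3⟩
    rw [h2, childNo_snoc] at h1
    obtain rfl : j' = j := by omega
    exact ⟨m.1, j', h2, h3⟩

theorem Walk.nextPos (i : Fin k) [Fintype Sig] :
    Walk i (fun (t : RTree Sig rank) (_ : List (X × Pos t)) u u' => nextPos t u u') := by
  refine ((Walk.down i 0).or ((Walk.leaf i).seq ((Walk.lastUp i).star.seq (Walk.sib i)))).congr ?_
  intro t π u u'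
  simp only [NestedPebbles.nextPos, and_assoc, exists_eq_left]

theorem Walk.isLast (i : Fin k) [Fintype Sig] :
    Walk i (fun (t : RTree Sig rank) (_ : List (X × Pos t)) u u' => u' = rootPos t ∧ isLast t u) := by
  refine ((Walk.leaf i).seq ((Walk.lastUp i).star.seq (Walk.chno i true 0))).congr ?_
  intro t π u u'
  simp only [NestedPebbles.isLast, and_assoc, exists_eq_left, iff_true, childNo_eq_zero]
  constructor
  · rintro ⟨rfl, h1, h2⟩
    exact ⟨h1, rootPos t, h2, rfl, rfl⟩
  · rintro ⟨h1, w, h2, rfl, h3⟩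
    have : u' = rootPos t := Subtype.ext h3
    subst this
    exact ⟨rfl, h1, h2⟩

/-- Perform `B` at every node, in document order. -/
theorem Realizable.traverse (i : Fin k) [Fintype Sig] {B : CRel Sig rank k X} (hB : Realizable B) :
    ∃ T : CRel Sig rank k X, Realizable T ∧ ∀ t π (ok : Pos t → Prop),
      (∀ h c', B t (h, π) c' ↔ c'.2 = π ∧ c'.1 i = h i ∧ ok (h i)) →
      ∀ h c', T t (h, π) c' ↔ c'.2 = π ∧ ∀ u, ok u := by
  refine ⟨_, ((Realizable.seq i (Walk.root i) hB).seq i ((Realizable.seq i (Walk.nextPos i) hB).star i)).seq i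
    (Realizable.seq i (Walk.isLast i) (Realizable.wanderAll i)), ?_⟩
  intro t π ok hok h c'
  constructor
  · rintro ⟨⟨h3, π3⟩, ⟨⟨h2, π2⟩, ⟨⟨h1, π1⟩, ⟨e1, e2, -⟩, hb⟩, hst⟩, ⟨h4, π4⟩, ⟨e4, ⟨-, e5⟩, -⟩, e6⟩
    simp only at e1 e2 e4 e5 e6
    subst e1 e4
    rw [hok] at hb
    obtain ⟨e7, e8, e9⟩ := hb
    simp only at e7 e8 e9
    subst e7
    have key : ∀ d, ReflTransGen (fun c c' => ∃ m, HRel i (fun t π u u' =>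
        NestedPebbles.nextPos t u u') t c m ∧ B t m c') (h2, π2) d →
        d.2 = π2 ∧ ReflTransGen (fun u u' => NestedPebbles.nextPos t u u' ∧ ok u')
          (rootPos t) (d.1 i) := by
      intro d hd
      induction hd with
      | refl => exact ⟨rfl, by simp only [e8, e2]; exact ReflTransGen.refl⟩
      | @tail a b _ hab ih =>
        obtain ⟨ih1, ih2⟩ := ih
        obtain ⟨⟨m1, m2⟩, ⟨f1, f2, -⟩, f3⟩ := hab
        simp only at f1 f2
        rw [ih1] at f1
        subst f1
        rw [hok] at f3
        refine ⟨f3.1, ih2.tail ⟨?_, ?_⟩⟩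
        · rw [f3.2.1]; exact f2
        · rw [f3.2.1]; exact f3.2.2
    obtain ⟨k1, k2⟩ := key _ hst
    simp only at k1 k2
    refine ⟨by rw [e6, k1], trav_sound ?_ k2 e5⟩
    rw [← e2]; exact e9
  · obtain ⟨h', π'⟩ := c'
    rintro ⟨e1, hall⟩
    simp only at e1
    subst e1
    obtain ⟨w, hw, hw'⟩ := trav_complete t
    have key : ∀ w, ReflTransGen (NestedPebbles.nextPos t) (rootPos t) w →
        ReflTransGen (fun c c' => ∃ m, HRel i (fun t π u u' =>
        NestedPebbles.nextPos t u u') t c m ∧ B t m c') (Function.update h i (rootPos t), π')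
        (Function.update h i w, π') := by
      intro w hw
      induction hw with
      | refl => exact ReflTransGen.refl
      | @tail a b _ hab ih =>
        refine ih.tail ⟨(Function.update h i b, π'), ⟨rfl, by simpa using hab, ?_⟩, ?_⟩
        · intro j hj; simp [hj]
        · rw [hok]; exact ⟨rfl, rfl, hall _⟩
    refine ⟨(Function.update h i w, π'), ⟨(Function.update h i (rootPos t), π'),
      ⟨(Function.update h i (rootPos t), π'), ⟨rfl, by simp, ?_⟩, ?_⟩, key w hw⟩,
      (Function.update h i (rootPos t), π'), ⟨rfl, by simpa using hw', ?_⟩, rfl⟩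
    · intro j hj; simp [hj]
    · rw [hok]; exact ⟨rfl, rfl, hall _⟩
    · intro j hj; simp [hj]

end Traverse
section Test
open Relation

variable {Sig : Type} {rank : Sig → ℕ} {k : ℕ} {N : ℕ}

/-- The pebble stack `π` represents the valuation `ν` on `F`, variable `x` being represented by
pebble `ρ x`; all pebbles on the stack have number less than `d`. -/
def Valid {t : RTree Sig rank} (F : Set ℕ) (d : ℕ) (ρ : ℕ → Fin N) (ν : ℕ → Pos t)
    (π : List (Fin N × Pos t)) : Prop :=
  (∀ x ∈ F, ∀ w, (ρ x, w) ∈ π ↔ w = ν x) ∧ ∀ p w, (p, w) ∈ π → p.val < d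

theorem Valid.mono {t : RTree Sig rank} {F G : Set ℕ} {d : ℕ} {ρ : ℕ → Fin N} {ν : ℕ → Pos t}
    {π : List (Fin N × Pos t)} (h : Valid G d ρ ν π) (hFG : F ⊆ G) : Valid F d ρ ν π :=
  ⟨fun x hx => h.1 x (hFG hx), h.2⟩

/-- The predicate `P` can be tested by an automaton fragment. -/
def Testable (k : ℕ) (N : ℕ) (d : ℕ) (F : Set ℕ) (ρ : ℕ → Fin N)
    (P : ∀ t : RTree Sig rank, (ℕ → Pos t) → Prop) : Prop :=
  ∃ R : CRel Sig rank k (Fin N), Realizable R ∧ ∀ t ν π, Valid F d ρ ν π →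
    ∀ h c', R t (h, π) c' ↔ c'.2 = π ∧ P t ν

variable {d : ℕ} {F G : Set ℕ} {ρ : ℕ → Fin N} {P P' : ∀ t : RTree Sig rank, (ℕ → Pos t) → Prop}

theorem Testable.congr (hP : Testable k N d F ρ P) (h : ∀ t ν, P' t ν ↔ P t ν) :
    Testable k N d F ρ P' := by
  obtain ⟨R, hR, H⟩ := hP
  exact ⟨R, hR, fun t ν π hv g c' => by rw [H t ν π hv, h]⟩

theorem Testable.mono (hP : Testable k N d F ρ P) (h : F ⊆ G) : Testable k N d G ρ P := by
  obtain ⟨R, hR, H⟩ := hP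
  exact ⟨R, hR, fun t ν π hv => H t ν π (hv.mono h)⟩

theorem Testable.and (i0 : Fin k) (hP : Testable k N d F ρ P) (hP' : Testable k N d G ρ P') :
    Testable k N d (F ∪ G) ρ (fun t ν => P t ν ∧ P' t ν) := by
  obtain ⟨R, hR, H⟩ := hP
  obtain ⟨R', hR', H'⟩ := hP'
  refine ⟨_, hR.seq i0 hR', ?_⟩
  intro t ν π hv h c'
  constructor
  · rintro ⟨⟨m1, m2⟩, h1, h2⟩
    rw [H t ν π (hv.mono Set.subset_union_left)] at h1
    obtain ⟨h1, h3⟩ := h1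
    simp only at h1
    subst h1
    rw [H' t ν m2 (hv.mono Set.subset_union_right)] at h2
    exact ⟨h2.1, h3, h2.2⟩
  · rintro ⟨h1, h2, h3⟩
    exact ⟨(h, π), (H t ν π (hv.mono Set.subset_union_left) _ _).2 ⟨rfl, h2⟩,
      (H' t ν π (hv.mono Set.subset_union_right) _ _).2 ⟨h1, h3⟩⟩

theorem Testable.or (i0 : Fin k) (hP : Testable k N d F ρ P) (hP' : Testable k N d G ρ P') :
    Testable k N d (F ∪ G) ρ (fun t ν => P t ν ∨ P' t ν) := by
  obtain ⟨R, hR, H⟩ := hP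
  obtain ⟨R', hR', H'⟩ := hP'
  refine ⟨_, hR.or i0 hR', ?_⟩
  intro t ν π hv h c'
  simp only [H t ν π (hv.mono Set.subset_union_left), H' t ν π (hv.mono Set.subset_union_right)]
  tauto

theorem Testable.walk [Fintype Sig] (i0 : Fin k) {r : PRel Sig rank (Fin N)} (hr : Walk i0 r)
    (h : ∀ t ν π, Valid F d ρ ν π → ∀ u, (∃ u', r t π u u') ↔ P t ν) : Testable k N d F ρ P := by
  refine ⟨_, Realizable.seq i0 hr (Realizable.wanderAll i0), ?_⟩
  intro t ν π hv g c'
  rw [← h t ν π hv (g i0)]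
  constructor
  · rintro ⟨m, ⟨h1, h2, -⟩, h3⟩
    exact ⟨h3.trans h1, _, h2⟩
  · rintro ⟨h1, u', h2⟩
    refine ⟨(Function.update g i0 u', π), ⟨rfl, by simpa using h2, ?_⟩, h1⟩
    intro j hj; simp [hj]

theorem Valid.push {t : RTree Sig rank} {ν : ℕ → Pos t} {π : List (Fin N × Pos t)} {x : ℕ}
    (hd : d < N) (u : Pos t) (hv : Valid (F \ {x}) d ρ ν π) :
    Valid F (d + 1) (Function.update ρ x ⟨d, hd⟩) (Function.update ν x u) ((⟨d, hd⟩, u) :: π) := by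
  have hfresh : ∀ w, ((⟨d, hd⟩ : Fin N), w) ∉ π := fun w hw => absurd (hv.2 _ _ hw) (lt_irrefl _)
  constructor
  · intro y hy w
    by_cases hyx : y = x
    · subst hyx
      simp [hfresh]
    · have h1 := hv.1 y ⟨hy, hyx⟩
      have h2 := hv.2 _ _ ((h1 _).2 rfl)
      have h3 : ρ y ≠ ⟨d, hd⟩ := by
        intro h; rw [h] at h2; exact absurd h2 (lt_irrefl _)
      simp [hyx, h1, h3]
  · intro p w hw
    simp only [List.mem_cons, Prod.mk.injEq] at hw
    rcases hw with ⟨rfl, _⟩ | hw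
    · simp
    · exact (hv.2 _ _ hw).trans (Nat.lt_succ_self d)

theorem Testable.ex [Fintype Sig] (i0 : Fin k) (hd : d < N) {x : ℕ}
    (hP : Testable k N (d + 1) F (Function.update ρ x ⟨d, hd⟩) P) :
    Testable k N d (F \ {x}) ρ (fun t ν => ∃ u, P t (Function.update ν x u)) := by
  obtain ⟨R, hR, H⟩ := hP
  refine ⟨_, (((Realizable.wanderAll i0).seq i0
    (Realizable.instr (TInstr.dropPeb i0 ⟨d, hd⟩))).seq i0 hR).seq i0
    (Realizable.instr (TInstr.retrieve ⟨d, hd⟩)), ?_⟩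
  rintro t ν π hv h ⟨h', π'⟩
  have hfresh : ∀ w, ((⟨d, hd⟩ : Fin N), w) ∉ π := fun w hw => absurd (hv.2 _ _ hw) (lt_irrefl _)
  constructor
  · rintro ⟨⟨h3, π3⟩, ⟨⟨h2, π2⟩, ⟨⟨h1, π1⟩, e1, e2, e3, -⟩, e4⟩, e5, w, e6⟩
    simp only at e1 e2 e3 e5 e6
    subst e1 e2 e3
    rw [H t _ _ (hv.push hd (h2 i0))] at e4
    obtain ⟨e7, e8⟩ := e4
    simp only at e7
    rw [e7] at e6
    simp only [List.cons.injEq] at e6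
    exact ⟨e6.2.symm, _, e8⟩
  · rintro ⟨e1, u, hu⟩
    simp only at e1
    subst e1
    refine ⟨(h', (⟨d, hd⟩, u) :: π'), ⟨(fun _ => u, (⟨d, hd⟩, u) :: π'),
      ⟨(fun _ => u, π'), rfl, rfl, rfl, hfresh⟩, ?_⟩, rfl, u, rfl⟩
    rw [H t _ _ (hv.push hd u)]
    exact ⟨rfl, hu⟩

theorem Testable.all [Fintype Sig] (i0 : Fin k) (hd : d < N) {x : ℕ}
    (hP : Testable k N (d + 1) F (Function.update ρ x ⟨d, hd⟩) P) :
    Testable k N d (F \ {x}) ρ (fun t ν => ∀ u, P t (Function.update ν x u)) := by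
  obtain ⟨R, hR, H⟩ := hP
  obtain ⟨T, hT, HT⟩ := Realizable.traverse i0
    (((Realizable.instr (TInstr.dropPeb i0 ⟨d, hd⟩)).seq i0 hR).seq i0
    (Realizable.seq i0 (Walk.goto i0 ⟨d, hd⟩) (Realizable.instr (TInstr.retrieve ⟨d, hd⟩))))
  refine ⟨T, hT, ?_⟩
  intro t ν π hv
  have hfresh : ∀ w, ((⟨d, hd⟩ : Fin N), w) ∉ π := fun w hw => absurd (hv.2 _ _ hw) (lt_irrefl _)
  refine HT t π (fun u => P t (Function.update ν x u)) ?_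
  rintro h ⟨h', π'⟩
  constructor
  · rintro ⟨⟨h3, π3⟩, ⟨⟨h1, π1⟩, ⟨e1, e2, -⟩, e4⟩, ⟨h4, π4⟩, ⟨e5, e6, -⟩, e7, w, e8⟩
    simp only at e1 e2 e4 e5 e6 e7 e8
    subst e1 e2 e5 e7
    rw [H t _ _ (hv.push hd (h1 i0))] at e4
    obtain ⟨e9, e10⟩ := e4
    simp only at e9
    subst e9
    simp only [List.cons.injEq] at e8
    simp only [List.mem_cons, Prod.mk.injEq, true_and, hfresh, or_false] at e6
    exact ⟨e8.2.symm, e6, e10⟩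
  · rintro ⟨e1, e2, e3⟩
    simp only at e1 e2 e3
    subst e1
    refine ⟨(h', (⟨d, hd⟩, h i0) :: π'), ⟨(h, (⟨d, hd⟩, h i0) :: π'), ⟨rfl, rfl, hfresh⟩, ?_⟩,
      (h', (⟨d, hd⟩, h i0) :: π'), ⟨rfl, by simp [e2], fun _ _ => rfl⟩, rfl, _, rfl⟩
    rw [H t _ _ (hv.push hd (h i0))]
    exact ⟨rfl, e3⟩

/-- Stack after dropping the pebbles `d, …, d + k - 1` at `a`. -/
def pushAll {t : RTree Sig rank} (q : Fin k → Fin N) (a : Fin k → Pos t)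
    (π : List (Fin N × Pos t)) : List (Fin N × Pos t) :=
  (List.finRange k).map (fun i => (q i, a i)) ++ π

theorem mem_pushAll {t : RTree Sig rank} (q : Fin k → Fin N) (a : Fin k → Pos t)
    (π : List (Fin N × Pos t)) (p : Fin N) (w : Pos t) :
    (p, w) ∈ pushAll q a π ↔ (∃ i, q i = p ∧ a i = w) ∨ (p, w) ∈ π := by
  simp [pushAll]

theorem Valid.pushVec {t : RTree Sig rank} {ν : ℕ → Pos t} {π : List (Fin N × Pos t)}
    {xs : Fin k → ℕ} (q : Fin k → Fin N) (hq : ∀ i, (q i).val = d + i.val) (a : Fin k → Pos t)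
    (hv : Valid (F \ Set.range xs) d ρ ν π) :
    Valid F (d + k) (updVec ρ xs q) (updVec ν xs a) (pushAll q a π) := by
  have hfresh : ∀ i w, (q i, w) ∉ π := by
    intro i w hw
    have := hv.2 _ _ hw
    rw [hq] at this
    omega
  have hinj : ∀ i j, q i = q j ↔ i = j := by
    intro i j
    constructor
    · intro h
      have := congrArg Fin.val h
      rw [hq, hq] at this
      exact Fin.ext (by omega)
    · rintro rfl; rfl
  constructor
  · intro y hy w
    rw [mem_pushAll]
    by_cases hyx : ∃ i, xs i = y
    · simp only [updVec, hyx, dif_pos, hinj, hfresh, or_false, exists_eq_left]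
      exact eq_comm
    · have h1 := hv.1 y ⟨hy, by simpa using hyx⟩
      have h2 := hv.2 _ _ ((h1 _).2 rfl)
      have h3 : ∀ i, q i ≠ ρ y := by
        intro i h; rw [← h, hq] at h2; omega
      simp [updVec, hyx, h1, h3]
  · intro p w hw
    rw [mem_pushAll] at hw
    rcases hw with ⟨i, rfl, _⟩ | hw
    · rw [hq]; omega
    · have := hv.2 _ _ hw
      omega

theorem Testable.tcBody [Fintype Sig] (i0 : Fin k) {xs ys : Fin k → ℕ}
    (q q' : Fin k → Fin N) (hq : ∀ i, (q i).val = d + i.val)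
    (hq' : ∀ i, (q' i).val = d + k + i.val)
    (hP : Testable k N (d + k + k) F (updVec (updVec ρ xs q) ys q') P) :
    ∃ B : CRel Sig rank k (Fin N), Realizable B ∧ ∀ t ν π,
      Valid ((F \ Set.range ys) \ Set.range xs) d ρ ν π → ∀ a c', B t (a, π) c' ↔
        c'.2 = π ∧ P t (updVec (updVec ν xs a) ys c'.1) := by
  obtain ⟨R, hR, H⟩ := hP
  have hinj : Function.Injective q := by
    intro i j h
    have := congrArg Fin.val h
    rw [hq, hq] at this
    exact Fin.ext (by omega)
  have hinj' : Function.Injective q' := by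
    intro i j h
    have := congrArg Fin.val h
    rw [hq', hq'] at this
    exact Fin.ext (by omega)
  obtain ⟨D, hD, HD⟩ := Realizable.dropL (Sig := Sig) (rank := rank) i0 q hinj _
    (List.nodup_finRange k)
  obtain ⟨D', hD', HD'⟩ := Realizable.dropL (Sig := Sig) (rank := rank) i0 q' hinj' _
    (List.nodup_finRange k)
  obtain ⟨Z, hZ, HZ⟩ := Realizable.retrieveL (Sig := Sig) (rank := rank) i0 q (List.finRange k)
  obtain ⟨Z', hZ', HZ'⟩ := Realizable.retrieveL (Sig := Sig) (rank := rank) i0 q' (List.finRange k)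
  refine ⟨_, (((((hD.seq i0 (Realizable.wanderAll i0)).seq i0 hD').seq i0 hR).seq i0
    (Realizable.gotoAll i0 q')).seq i0 hZ').seq i0 hZ, ?_⟩
  intro t ν π hv1 a
  have hfresh : ∀ i w, (q i, w) ∉ π := by
    intro i w hw
    have := hv1.2 _ _ hw
    rw [hq] at this
    omega
  have hfresh' : ∀ i w, (q' i, w) ∉ pushAll q a π := by
    intro i w hw
    have := (hv1.pushVec q hq a).2 _ _ hw
    rw [hq'] at this
    omega
  have hv2 : ∀ b, Valid F (d + k + k) (updVec (updVec ρ xs q) ys q')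
      (updVec (updVec ν xs a) ys b) (pushAll q' b (pushAll q a π)) :=
    fun b => (hv1.pushVec q hq a).pushVec q' hq' b
  have hgo : ∀ b b' : Fin k → Pos t, (∀ i, (q' i, b' i) ∈ pushAll q' b (pushAll q a π)) ↔ b' = b := by
    intro b b'
    simp only [mem_pushAll q' b, hfresh', or_false, hinj'.eq_iff, exists_eq_left]
    rw [funext_iff]
    simp only [eq_comm]
  rintro ⟨h', π'⟩
  constructor
  · rintro ⟨⟨h6, π6⟩, ⟨⟨h5, π5⟩, ⟨⟨h4, π4⟩, ⟨⟨h3, π3⟩, ⟨⟨h2, π2⟩, ⟨⟨h1, π1⟩, e1, e2⟩, e3⟩, e4⟩, e5, e5'⟩,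
      e6⟩, e7⟩
    rw [HD t a π hfresh] at e1
    obtain ⟨rfl, rfl⟩ := Prod.mk.inj e1
    simp only at e2 e5 e5'
    subst e2 e5
    have e3' := (HD' t h2 _ hfresh' _).1 e3
    obtain ⟨rfl, rfl⟩ := Prod.mk.inj e3'
    have e4' := (H t _ _ (hv2 h3) _ _).1 e4
    obtain ⟨e8, e9⟩ := e4'
    simp only at e8
    subst e8
    have e10 := (hgo h3 h5).1 e5'
    subst e10
    have e11 := (HZ' t _ _ _ _).1 e6
    obtain ⟨rfl, rfl⟩ := Prod.mk.inj e11
    have e12 := (HZ t _ _ _ _).1 e7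
    obtain ⟨rfl, rfl⟩ := Prod.mk.inj e12
    exact ⟨rfl, e9⟩
  · rintro ⟨e1, e2⟩
    simp only at e1 e2
    subst e1
    refine ⟨(h', pushAll q a π'), ⟨(h', pushAll q' h' (pushAll q a π')),
      ⟨(h', pushAll q' h' (pushAll q a π')), ⟨(h', pushAll q' h' (pushAll q a π')),
      ⟨(h', pushAll q a π'), ⟨(a, pushAll q a π'), ?_, rfl⟩, ?_⟩, ?_⟩, rfl, ?_⟩, ?_⟩, ?_⟩
    · exact (HD t a π' hfresh _).2 rfl
    · exact (HD' t h' _ hfresh' _).2 rfl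
    · exact (H t _ _ (hv2 h') _ _).2 ⟨rfl, e2⟩
    · exact (hgo h' h').2 rfl
    · exact (HZ' t h' h' _ _).2 rfl
    · exact (HZ t h' a _ _).2 rfl

theorem Testable.tc [Fintype Sig] (i0 : Fin k) {xs ys us vs : Fin k → ℕ}
    (q q' : Fin k → Fin N) (hq : ∀ i, (q i).val = d + i.val)
    (hq' : ∀ i, (q' i).val = d + k + i.val)
    (hP : Testable k N (d + k + k) F (updVec (updVec ρ xs q) ys q') P) :
    Testable k N d ((F \ (Set.range xs ∪ Set.range ys)) ∪ Set.range us ∪ Set.range vs) ρ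
      (fun t ν => ReflTransGen (fun a b : Fin k → Pos t => P t (updVec (updVec ν xs a) ys b))
        (fun i => ν (us i)) (fun i => ν (vs i))) := by
  obtain ⟨B, hB, HB⟩ := hP.tcBody i0 q q' hq hq'
  refine ⟨_, (((Realizable.gotoAll i0 (fun i => ρ (us i))).seq i0 (hB.star i0)).seq i0
    (Realizable.checkAll i0 (fun i => ρ (vs i)))).seq i0 (Realizable.wanderAll i0), ?_⟩
  intro t ν π hv
  have hv1 : Valid ((F \ Set.range ys) \ Set.range xs) d ρ ν π := by
    refine hv.mono ?_
    rintro x ⟨⟨h1, h2⟩, h3⟩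
    exact Or.inl (Or.inl ⟨h1, by rintro (h | h) <;> contradiction⟩)
  have hu : ∀ i w, (ρ (us i), w) ∈ π ↔ w = ν (us i) :=
    fun i w => hv.1 _ (Or.inl (Or.inr ⟨i, rfl⟩)) w
  have hw : ∀ i w, (ρ (vs i), w) ∈ π ↔ w = ν (vs i) :=
    fun i w => hv.1 _ (Or.inr ⟨i, rfl⟩) w
  have hstar : ∀ a c', ReflTransGen (B t) (a, π) c' ↔ c'.2 = π ∧
      ReflTransGen (fun a b : Fin k → Pos t => P t (updVec (updVec ν xs a) ys b)) a c'.1 := by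
    intro a c'
    constructor
    · intro h
      induction h with
      | refl => exact ⟨rfl, ReflTransGen.refl⟩
      | @tail x y _ hxy ih =>
        obtain ⟨x1, x2⟩ := x
        obtain ⟨i1, i2⟩ := ih
        simp only at i1 i2
        subst i1
        have := (HB t ν x2 hv1 _ _).1 hxy
        exact ⟨this.1, i2.tail this.2⟩
    · obtain ⟨b, π'⟩ := c'
      rintro ⟨h1, h2⟩
      simp only at h1 h2
      subst h1
      induction h2 with
      | refl => exact ReflTransGen.refl
      | @tail x y _ hxy ih => exact ih.tail ((HB t ν π' hv1 _ _).2 ⟨rfl, hxy⟩)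
  rintro h ⟨h', π'⟩
  constructor
  · rintro ⟨⟨h3, π3⟩, ⟨⟨h2, π2⟩, ⟨⟨h1, π1⟩, ⟨e1, e2⟩, e3⟩, e4, e5⟩, e6⟩
    simp only at e1 e2 e4 e5 e6
    subst e1 e6
    obtain ⟨rfl, rfl⟩ := Prod.mk.inj e4
    rw [hstar] at e3
    obtain ⟨e7, e8⟩ := e3
    simp only at e7 e8
    subst e7
    have f1 : h1 = fun i => ν (us i) := funext fun i => (hu i _).1 (e2 i)
    have f2 : h3 = fun i => ν (vs i) := funext fun i => (hw i _).1 (e5 i)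
    subst f1 f2
    exact ⟨rfl, e8⟩
  · rintro ⟨e1, e2⟩
    simp only at e1
    subst e1
    refine ⟨(fun i => ν (vs i), π'), ⟨(fun i => ν (vs i), π'), ⟨(fun i => ν (us i), π'),
      ⟨rfl, ?_⟩, ?_⟩, rfl, ?_⟩, rfl⟩
    · exact fun i => (hu i _).2 rfl
    · exact (hstar _ _).2 ⟨rfl, e2⟩
    · exact fun i => (hw i _).2 rfl

end Test
section Formulas
open Relation

variable {Sig : Type} {rank : Sig → ℕ} {k : ℕ} {N : ℕ} {d : ℕ} {ρ : ℕ → Fin N}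

theorem testable_lab [Fintype Sig] (i0 : Fin k) (b : Bool) (a : Sig) (x : ℕ) :
    Testable (rank := rank) k N d {x} ρ (fun t ν => labelAt t (ν x).1 = some a ↔ b = true) := by
  refine Testable.walk i0 ((Walk.goto i0 (ρ x)).seq (Walk.lab i0 b a)) ?_
  intro t ν π hv u
  simp [hv.1 x rfl]

theorem testable_eq [Fintype Sig] (i0 : Fin k) (b : Bool) (x y : ℕ) :
    Testable (Sig := Sig) (rank := rank) k N d {x, y} ρ (fun t ν => ν x = ν y ↔ b = true) := by
  refine Testable.walk i0 ((Walk.goto i0 (ρ x)).seq (Walk.peb i0 b (ρ y))) ?_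
  intro t ν π hv u
  simp [hv.1 x (Or.inl rfl), hv.1 y (Or.inr rfl)]

theorem testable_edg [Fintype Sig] (i0 : Fin k) (i x y : ℕ) :
    Testable (Sig := Sig) (rank := rank) k N d {x, y} ρ
      (fun t ν => 1 ≤ i ∧ (ν y).1 = (ν x).1 ++ [i - 1]) := by
  cases i with
  | zero => exact Testable.walk i0 Walk.never (by simp)
  | succ i =>
    refine Testable.walk i0 (((Walk.goto i0 (ρ x)).seq (Walk.down i0 i)).seq
      (Walk.peb i0 true (ρ y))) ?_
    intro t ν π hv u
    simp [hv.1 x (Or.inl rfl), hv.1 y (Or.inr rfl)]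

theorem testable_not_edg [Fintype Sig] (i0 : Fin k) (i x y : ℕ) :
    Testable (Sig := Sig) (rank := rank) k N d {x, y} ρ
      (fun t ν => ¬ (1 ≤ i ∧ (ν y).1 = (ν x).1 ++ [i - 1])) := by
  cases i with
  | zero => exact Testable.walk i0 (Walk.wander i0) (by intro t ν π _ u; simp; exact ⟨rootPos t⟩)
  | succ i =>
    refine Testable.walk i0 ((Walk.goto i0 (ρ y)).seq ((Walk.chno i0 false (i + 1)).or
      ((Walk.up i0).seq (Walk.peb i0 false (ρ x))))) ?_
    intro t ν π hv u
    simp only [hv.1 x (Or.inl rfl), hv.1 y (Or.inr rfl), exists_eq_left, Bool.false_eq_true, iff_false,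
      Nat.le_add_left, true_and, Nat.add_sub_cancel]
    constructor
    · rintro ⟨u', (⟨rfl, h⟩ | ⟨m, ⟨j, h1⟩, rfl, h2⟩)⟩ he
      · rw [he, childNo_snoc] at h
        exact h rfl
      · rw [he] at h1
        have := List.append_inj' h1 rfl
        exact h2 (Subtype.ext this.1.symm)
    · intro he
      rcases List.eq_nil_or_concat (ν y).1 with h | ⟨p, j, h⟩
      · refine ⟨ν y, Or.inl ⟨rfl, ?_⟩⟩
        rw [(childNo_eq_zero _).2 h]; omega
      · rw [List.concat_eq_append] at h
        by_cases hj : j = i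
        · subst hj
          have hp : IsPos t p := isPos_prefix t ⟨[j], h.symm⟩ (ν y).2
          refine ⟨⟨p, hp⟩, Or.inr ⟨⟨p, hp⟩, ⟨j, h⟩, rfl, ?_⟩⟩
          intro hx
          apply he
          rw [← hx, h]
        · refine ⟨ν y, Or.inl ⟨rfl, ?_⟩⟩
          rw [h, childNo_snoc]; omega

theorem testable_le [Fintype Sig] (i0 : Fin k) (x y : ℕ) :
    Testable (Sig := Sig) (rank := rank) k N d {x, y} ρ
      (fun t ν => (ν x).1 <+: (ν y).1) := by
  refine Testable.walk i0 (((Walk.goto i0 (ρ y)).seq (Walk.up i0).star).seq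
    (Walk.peb i0 true (ρ x))) ?_
  intro t ν π hv u
  simp only [hv.1 x (Or.inl rfl), hv.1 y (Or.inr rfl), exists_eq_left, iff_true]
  constructor
  · rintro ⟨u', m, h, h1, h2⟩
    rw [← h2]
    clear h1 h2
    induction h with
    | refl => exact List.prefix_refl _
    | @tail a b _ hab ih =>
      obtain ⟨j, hj⟩ := hab
      exact List.IsPrefix.trans ⟨[j], hj.symm⟩ ih
  · rintro ⟨r, hr⟩
    refine ⟨ν x, ν x, ?_, rfl, rfl⟩
    generalize ν y = w at hr
    induction r using List.reverseRecOn generalizing w with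
    | nil =>
      rw [List.append_nil] at hr
      rw [show ν x = w from Subtype.ext hr]
    | append_singleton r j ih =>
      have hp : IsPos t ((ν x).1 ++ r) := isPos_prefix t ⟨[j], by simpa using hr⟩ w.2
      exact ReflTransGen.head ⟨j, by rw [← hr]; simp⟩ (ih ⟨_, hp⟩ rfl)

theorem testable_not_le [Fintype Sig] (i0 : Fin k) (x y : ℕ) :
    Testable (Sig := Sig) (rank := rank) k N d {x, y} ρ
      (fun t ν => ¬ (ν x).1 <+: (ν y).1) := by
  refine Testable.walk i0 (((Walk.goto i0 (ρ y)).seq ((Walk.peb i0 false (ρ x)).seq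
    (Walk.up i0)).star).seq ((Walk.peb i0 false (ρ x)).seq (Walk.chno i0 true 0))) ?_
  intro t ν π hv u
  simp only [hv.1 x (Or.inl rfl), hv.1 y (Or.inr rfl), exists_eq_left, iff_true,
    Bool.false_eq_true, iff_false, and_assoc, childNo_eq_zero]
  constructor
  · rintro ⟨u', m, h, h1, h2, h3⟩ hle
    have key : (ν x).1 <+: m.1 := by
      clear h1 h2 h3
      induction h with
      | refl => exact hle
      | @tail a b _ hab ih =>
        obtain ⟨hne, j, hj⟩ := hab
        rw [hj] at ih
        rw [List.prefix_concat_iff] at ih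
        rcases ih with ih | ih
        · exact absurd (Subtype.ext (hj.trans ih.symm)) hne
        · exact ih
    rw [h3, List.prefix_nil] at key
    exact h1 (Subtype.ext (h3.trans key.symm))
  · intro hle
    refine ⟨rootPos t, rootPos t, ?_, ?_, rfl, rfl⟩
    · generalize ν y = w at hle
      obtain ⟨p, hp⟩ := w
      induction p using List.reverseRecOn with
      | nil => exact ReflTransGen.refl
      | append_singleton p j ih =>
        have hp' := isPos_prefix t (List.prefix_append p [j]) hp
        refine ReflTransGen.head (b := ⟨p, hp'⟩) ⟨?_, j, rfl⟩ (ih hp' ?_)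
        · intro h
          rw [← h] at hle
          exact hle (List.prefix_refl _)
        · intro h
          exact hle (h.trans (List.prefix_append p [j]))
    · intro h
      rw [← h] at hle
      exact hle (by simp [rootPos])

/-- Number of pebbles needed for a formula. -/
def pebbleDepth : TForm Sig rank k → ℕ
  | .lab _ _ => 0
  | .edg _ _ _ => 0
  | .le _ _ => 0
  | .eq _ _ => 0
  | .not φ => pebbleDepth φ
  | .and φ ψ => max (pebbleDepth φ) (pebbleDepth ψ)
  | .or φ ψ => max (pebbleDepth φ) (pebbleDepth ψ)
  | .ex _ φ => pebbleDepth φ + 1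
  | .all _ φ => pebbleDepth φ + 1
  | .tc _ _ φ _ _ => pebbleDepth φ + k + k

theorem testable_form [Fintype Sig] (i0 : Fin k) (φ : TForm Sig rank k) :
    ∀ (b : Bool) (d : ℕ) (ρ : ℕ → Fin N), PosTC b φ → d + pebbleDepth φ ≤ N →
      Testable k N d (freeVars φ) ρ (fun t ν => Sat t φ ν ↔ b = true) := by
  induction φ with
  | lab a x => intro b d ρ _ _; exact testable_lab i0 b a x
  | eq x y => intro b d ρ _ _; exact testable_eq i0 b x y
  | edg i x y =>
    intro b d ρ _ _
    cases b
    · exact (testable_not_edg i0 i x y).congr (by simp [Sat])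
    · exact (testable_edg i0 i x y).congr (by simp [Sat])
  | le x y =>
    intro b d ρ _ _
    cases b
    · exact (testable_not_le i0 x y).congr (by simp [Sat])
    · exact (testable_le i0 x y).congr (by simp [Sat])
  | not φ ih =>
    intro b d ρ h1 h2
    refine (ih (!b) d ρ h1 h2).congr ?_
    intro t ν
    cases b <;> simp [Sat]
  | and φ ψ ih1 ih2 =>
    intro b d ρ h1 h2
    simp only [pebbleDepth] at h2
    have t1 := ih1 b d ρ h1.1 (by omega)
    have t2 := ih2 b d ρ h1.2 (by omega)
    cases b
    · exact (t1.or i0 t2).congr (by intro t ν; simp only [Sat]; grind)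
    · exact (t1.and i0 t2).congr (by simp [Sat])
  | or φ ψ ih1 ih2 =>
    intro b d ρ h1 h2
    simp only [pebbleDepth] at h2
    have t1 := ih1 b d ρ h1.1 (by omega)
    have t2 := ih2 b d ρ h1.2 (by omega)
    cases b
    · exact (t1.and i0 t2).congr (by simp [Sat])
    · exact (t1.or i0 t2).congr (by simp [Sat])
  | ex x φ ih =>
    intro b d ρ h1 h2
    simp only [pebbleDepth] at h2
    have t1 := ih b (d + 1) (Function.update ρ x ⟨d, by omega⟩) h1 (by omega)
    cases b
    · exact (t1.all i0 (by omega)).congr (by simp [Sat])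
    · exact (t1.ex i0 (by omega)).congr (by simp [Sat])
  | all x φ ih =>
    intro b d ρ h1 h2
    simp only [pebbleDepth] at h2
    have t1 := ih b (d + 1) (Function.update ρ x ⟨d, by omega⟩) h1 (by omega)
    cases b
    · exact (t1.ex i0 (by omega)).congr (by simp [Sat])
    · exact (t1.all i0 (by omega)).congr (by simp [Sat])
  | tc xs ys φ us vs ih =>
    intro b d ρ h1 h2
    simp only [pebbleDepth] at h2
    obtain ⟨rfl, h1⟩ := h1
    have t1 := ih true (d + k + k) (updVec (updVec ρ xs (fun i => ⟨d + i.val, by omega⟩)) ys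
      (fun i => ⟨d + k + i.val, by omega⟩)) h1 (by omega)
    refine (t1.tc i0 (us := us) (vs := vs) _ _ (fun _ => rfl) (fun _ => rfl)).congr ?_
    intro t ν
    simp [Sat]

end Formulas

/-- `FO+posTC^k ⊆ NPTWA^k`: every tree language definable in
first-order logic with positive occurrences of `k`-ary transitive closure is
accepted by a nondeterministic `k`-head tree-walking automaton with nested
pebbles. -/
theorem FOposTC_subset_NPTWA (Sig : Type) [Fintype Sig] (rank : Sig → ℕ)
    (k : ℕ) (hk : 1 ≤ k) :
    FOposTC Sig rank k ⊆ NPTWA Sig rank k := by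
  rintro L ⟨φ, -, hpos, hfree, rfl⟩
  have i0 : Fin k := ⟨0, hk⟩
  obtain ⟨R, hR, H⟩ := testable_form (N := pebbleDepth φ + 1) i0 φ true 0 (fun _ => 0) hpos
    (by omega)
  obtain ⟨A, hA⟩ := hR.exists_twa i0
  refine ⟨A, ?_⟩
  ext t
  have hv : Valid (freeVars φ) 0 (fun _ => (0 : Fin (pebbleDepth φ + 1)))
      (fun _ => rootPos t) [] := by
    constructor
    · intro x hx
      rw [hfree] at hx
      exact hx.elim
    · simp
  have h1 := H t _ _ hv (fun _ => rootPos t) (fun _ => rootPos t, [])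
  change Sat t φ (fun _ => rootPos t) ↔ Accepts A t
  rw [hA, h1]
  simp

end NestedPebbles
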